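/- arXiv:1608.01390 — 3 statements merged into one kernel-verified Lean document; each statement's English description precedes it below -/
import Mathlib

section
/- Let K be an imaginary quadratic field, and let 𝔞 and 𝔞′ be rank-1 K-lattices of conductors c and c′ respectively; set f′ = gcd(c, c′). Then the stabilizer {γ ∈ GL₂(K) : det γ = ±1 and γ·(𝔞 ⊕ 𝔞′) = 𝔞 ⊕ 𝔞′} of the lattice 𝔞 ⊕ 𝔞′ = {(x, y) ∈ K² : x ∈ 𝔞, y ∈ 𝔞′} equals the group Γ(𝔞, 𝔞′) = {γ ∈ GL₂(K) : det γ = ±1, γ₁₁ ∈ O_c, γ₂₂ ∈ O_{c′}, γ₁₂ ∈ c·𝔞·(f′·𝔞′)^{−1}, γ₂₁ ∈ c′·𝔞′·(f′·𝔞)^{−1}}. -/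
open scoped Pointwise

noncomputable section

variable (K : Type) [Field K] [NumberField K]

/-- The underlying set of the order `ℤ + m·O_K` of conductor `m` in `K`. -/
def orderSet (m : ℕ) : Set K :=
  {x : K | ∃ (a : ℤ) (y : NumberField.RingOfIntegers K),
    x = (a : K) + (m : K) * algebraMap (NumberField.RingOfIntegers K) K y}

/-- `L` is a rank-1 `K`-lattice: a finitely generated `ℤ`-submodule of `K`
spanning `K` over `ℚ`. -/
def IsLat (L : Submodule ℤ K) : Prop :=
  L.FG ∧ Submodule.span ℚ (L : Set K) = ⊤

/-- The multiplier ring `R(L) = {α ∈ K : α·L ⊆ L}` of a lattice, as a `ℤ`-submodule. -/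
def multLat (L : Submodule ℤ K) : Submodule ℤ K where
  carrier := {α : K | ∀ x ∈ L, α * x ∈ L}
  add_mem' := by
    intro a b ha hb x hx
    rw [add_mul]; exact L.add_mem (ha x hx) (hb x hx)
  zero_mem' := by intro x hx; rw [zero_mul]; exact L.zero_mem
  smul_mem' := by
    intro n a ha x hx
    rw [smul_mul_assoc]; exact L.smul_mem n (ha x hx)

/-- `L` has conductor `c`, i.e. the multiplier ring of `L` is the order `ℤ + c·O_K`. -/
def HasCond (L : Submodule ℤ K) (c : ℕ) : Prop :=
  0 < c ∧ (multLat K L : Set K) = orderSet K c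

/-- The inverse lattice `L⁻¹ = {x ∈ K : x·L ⊆ R(L)}`. -/
def invLat (L : Submodule ℤ K) : Submodule ℤ K where
  carrier := {x : K | ∀ y ∈ L, x * y ∈ multLat K L}
  add_mem' := by
    intro a b ha hb y hy
    rw [add_mul]; exact (multLat K L).add_mem (ha y hy) (hb y hy)
  zero_mem' := by intro y hy; rw [zero_mul]; exact (multLat K L).zero_mem
  smul_mem' := by
    intro n a ha y hy
    rw [smul_mul_assoc]; exact (multLat K L).smul_mem n (ha y hy)

/-- The lattice `A ⊕ B = {(x,y) ∈ K² : x ∈ A, y ∈ B}` in `K²`. -/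
def latPair (A B : Submodule ℤ K) : Submodule ℤ (Fin 2 → K) :=
  A.comap (LinearMap.proj (R := ℤ) (φ := fun _ : Fin 2 => K) 0) ⊓
    B.comap (LinearMap.proj (R := ℤ) (φ := fun _ : Fin 2 => K) 1)

variable {K}

/-- Every algebraic integer of a quadratic field is a root of a monic integral quadratic. -/
lemma exists_quadratic_of_integer (hdeg : Module.finrank ℚ K = 2)
    (u : NumberField.RingOfIntegers K) : ∃ s n : ℤ, u ^ 2 - (s : NumberField.RingOfIntegers K) * u
      + (n : NumberField.RingOfIntegers K) = 0 := by
  have hr : Module.finrank ℤ (NumberField.RingOfIntegers K) = 2 := by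
    rw [NumberField.RingOfIntegers.rank, hdeg]
  set φ := Algebra.lmul ℤ (NumberField.RingOfIntegers K) u
  have hnd : φ.charpoly.natDegree = 2 := by rw [LinearMap.charpoly_natDegree, hr]
  have hlc : φ.charpoly.coeff 2 = 1 := by
    rw [← hnd]; exact (LinearMap.charpoly_monic φ).leadingCoeff
  have h0 : Polynomial.aeval u φ.charpoly = 0 := by
    have h := LinearMap.aeval_self_charpoly φ
    rw [Polynomial.aeval_algHom_apply] at h
    exact (Algebra.lmul_injective (R := ℤ)) (by rw [h, map_zero])
  rw [Polynomial.aeval_eq_sum_range, hnd] at h0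
  simp only [Finset.sum_range_succ, Finset.sum_range_zero, hlc, zsmul_eq_mul] at h0
  refine ⟨-φ.charpoly.coeff 1, φ.charpoly.coeff 0, ?_⟩
  push_cast at h0 ⊢
  linear_combination h0

/-- A lattice in a quadratic field is generated by two elements, the first being nonzero. -/
lemma IsLat.exists_pair (hdeg : Module.finrank ℚ K = 2) {L : Submodule ℤ K} (hL : IsLat K L) :
    ∃ α β : K, α ≠ 0 ∧ L = Submodule.span ℤ {α, β} := by
  obtain ⟨hfg, hspan⟩ := hL
  have : Module.Finite ℤ L := Module.Finite.iff_fg.2 hfg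
  let b := Module.Free.chooseBasis ℤ L
  have hli : LinearIndependent ℤ (fun i => (b i : K)) :=
    b.linearIndependent.map' L.subtype (Submodule.ker_subtype L)
  have hliQ : LinearIndependent ℚ (fun i => (b i : K)) :=
    (LinearIndependent.iff_fractionRing ℤ ℚ).1 hli
  have hs : Submodule.span ℤ (Set.range (fun i => (b i : K))) = L := by
    have : Set.range (fun i => (b i : K)) = L.subtype '' Set.range b := by
      rw [← Set.range_comp]; rfl
    rw [this, Submodule.span_image, b.span_eq, Submodule.map_top, Submodule.range_subtype]
  have hsQ : Submodule.span ℚ (Set.range (fun i => (b i : K))) = ⊤ := by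
    rw [← Submodule.span_span_of_tower ℤ, hs, hspan]
  have hcard := finrank_span_eq_card hliQ
  rw [hsQ, finrank_top, hdeg] at hcard
  let e := Fintype.equivFinOfCardEq hcard.symm
  refine ⟨b (e.symm 0), b (e.symm 1), hliQ.ne_zero _, hs.symm.trans ?_⟩
  congr 1
  rw [← e.symm.surjective.range_comp]
  ext x
  simp only [Set.mem_range, Function.comp_apply, Fin.exists_fin_two, Set.mem_insert_iff,
    Set.mem_singleton_iff, eq_comm]

/-- Every element of a quadratic field is a root of a primitive integral quadratic polynomial. -/
lemma exists_primitive_quadratic (hdeg : Module.finrank ℚ K = 2) (τ : K) :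
    ∃ A B C u v w : ℤ, (A : K) * τ ^ 2 + B * τ + C = 0 ∧ u * A + v * B + w * C = 1 := by
  have h1 : ¬ LinearIndependent ℤ (fun i : Fin 3 => τ ^ (i : ℕ)) := by
    intro h
    have := ((LinearIndependent.iff_fractionRing ℤ ℚ).1 h).fintype_card_le_finrank
    simp [hdeg] at this
  obtain ⟨g, hg, i, hi⟩ := Fintype.not_linearIndependent_iff.1 h1
  obtain ⟨q, hq, hq1⟩ := Finset.extract_gcd (s := Finset.univ) g ⟨0, Finset.mem_univ _⟩
  set D := Finset.univ.gcd g
  have hD : (D : K) ≠ 0 := by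
    intro h
    have : D = 0 := by exact_mod_cast h
    apply hi
    rw [hq i (Finset.mem_univ _), this, zero_mul]
  simp only [Fin.sum_univ_three, zsmul_eq_mul] at hg
  rw [hq 0 (Finset.mem_univ _), hq 1 (Finset.mem_univ _), hq 2 (Finset.mem_univ _)] at hg
  obtain ⟨r, hr⟩ := Finset.gcd_eq_sum_mul Finset.univ q
  rw [hq1, Fin.sum_univ_three] at hr
  refine ⟨q 2, q 1, q 0, r 2, r 1, r 0, ?_, ?_⟩
  · apply (mul_eq_zero.1 _).resolve_left hD
    push_cast at hg
    simp at hg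
    linear_combination hg
  · linear_combination -hr

/-- Lattices in a quadratic field are invertible over their multiplier ring. -/
lemma IsLat.one_mem_mul_invLat (hdeg : Module.finrank ℚ K = 2) {L : Submodule ℤ K}
    (hL : IsLat K L) : (1 : K) ∈ L * invLat K L := by
  obtain ⟨α, β, hα, rfl⟩ := hL.exists_pair hdeg
  obtain ⟨A, B, C, u, v, w, hq, h1⟩ := exists_primitive_quadratic hdeg (β / α)
  have hq' : (A : K) * β ^ 2 / α + B * β + C * α = 0 := by
    field_simp at hq ⊢
    linear_combination hq
  set L := Submodule.span ℤ {α, β} with hLdef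
  have hαL : α ∈ L := Submodule.subset_span (by simp)
  have hβL : β ∈ L := Submodule.subset_span (by simp)
  have hzL : ∀ (n : ℤ) (x : K), x ∈ L → (n : K) * x ∈ L := fun n x hx => by
    rw [← zsmul_eq_mul]; exact L.smul_mem n hx
  have hmult : ∀ z : K, z * α ∈ L → z * β ∈ L → z ∈ multLat K L := by
    intro z h h' x hx
    obtain ⟨m, n, rfl⟩ := Submodule.mem_span_pair.1 hx
    rw [mul_add, mul_smul_comm, mul_smul_comm]
    exact L.add_mem (L.smul_mem _ h) (L.smul_mem _ h')
  have hinv : ∀ z : K, z * α ∈ multLat K L → z * β ∈ multLat K L → z ∈ invLat K L := by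
    intro z h h' x hx
    obtain ⟨m, n, rfl⟩ := Submodule.mem_span_pair.1 hx
    rw [mul_add, mul_smul_comm, mul_smul_comm]
    exact (multLat K L).add_mem ((multLat K L).smul_mem _ h) ((multLat K L).smul_mem _ h')
  have hint : ∀ n : ℤ, (n : K) ∈ multLat K L := fun n x hx => hzL n x hx
  have hAτ : (A : K) * (β / α) ∈ multLat K L := by
    apply hmult
    · rw [show (A : K) * (β / α) * α = A * β by field_simp]
      exact hzL _ _ hβL
    · rw [show (A : K) * (β / α) * β = ((-B : ℤ) : K) * β + ((-C : ℤ) : K) * α by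
        push_cast; linear_combination hq']
      exact L.add_mem (hzL _ _ hβL) (hzL _ _ hαL)
  have hz1 : (A : K) / α ∈ invLat K L := by
    apply hinv
    · rw [div_mul_cancel₀ _ hα]; exact hint A
    · rw [show (A : K) / α * β = A * (β / α) by ring]; exact hAτ
  have hz2 : ((B : K) + A * (β / α)) / α ∈ invLat K L := by
    apply hinv
    · rw [div_mul_cancel₀ _ hα]; exact (multLat K L).add_mem (hint B) hAτ
    · rw [show ((B : K) + A * (β / α)) / α * β = ((-C : ℤ) : K) by
        push_cast; linear_combination hq]
      exact hint _
  have e : (1 : K) = (u • (α * (A / α)) + v • (α * ((B + A * (β / α)) / α)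
      - β * (A / α))) - w • (β * ((B + A * (β / α)) / α)) := by
    have h1' : (u : K) * A + v * B + w * C = 1 := by exact_mod_cast h1
    have hα1 : α * α⁻¹ = 1 := mul_inv_cancel₀ hα
    simp only [zsmul_eq_mul, div_eq_mul_inv] at hq ⊢
    linear_combination (-1) * h1' + w * hq
      - (u * A + v * B + v * A * β * α⁻¹) * hα1
  rw [e]
  refine Submodule.sub_mem _ (Submodule.add_mem _ (Submodule.smul_mem _ _ ?_)
    (Submodule.smul_mem _ _ (Submodule.sub_mem _ ?_ ?_))) (Submodule.smul_mem _ _ ?_)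
  all_goals apply Submodule.mul_mem_mul <;> assumption

/-- If `O_K = ℤ + h·O_K` in a quadratic field, then `h` is a unit. -/
lemma isUnit_of_forall_eq_add_mul (hdeg : Module.finrank ℚ K = 2) (h : ℤ)
    (H : ∀ u : NumberField.RingOfIntegers K, ∃ (m : ℤ) (v : NumberField.RingOfIntegers K),
      u = m + h * v) : IsUnit h := by
  let P : Submodule ℤ (NumberField.RingOfIntegers K) := Submodule.span ℤ {1}
  obtain ⟨r, hr, hr'⟩ := Submodule.exists_sub_one_mem_and_smul_eq_zero_of_fg_of_le_smul
    (Ideal.span {h}) (⊤ : Submodule ℤ (NumberField.RingOfIntegers K ⧸ P)) Module.Finite.fg_top (by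
      rintro x -
      obtain ⟨u, rfl⟩ := P.mkQ_surjective x
      obtain ⟨m, v, rfl⟩ := H u
      have hm : P.mkQ (m : NumberField.RingOfIntegers K) = 0 := by
        rw [Submodule.mkQ_apply, Submodule.Quotient.mk_eq_zero]
        exact Submodule.mem_span_singleton.2 ⟨m, by simp⟩
      rw [map_add, hm, zero_add, ← zsmul_eq_mul, map_smul]
      exact Submodule.smul_mem_smul (Ideal.mem_span_singleton_self h) trivial)
  have hr0 : r = 0 := by
    by_contra hr0
    have hP : ∀ u : NumberField.RingOfIntegers K, r • u ∈ P := fun u => by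
      rw [← Submodule.Quotient.mk_eq_zero, Submodule.Quotient.mk_smul]
      exact hr' _ trivial
    have h2 := (LinearMap.finrank_le_finrank_of_injective
      (f := LinearMap.codRestrict P (LinearMap.lsmul ℤ _ r) hP) fun x y hxy => by
        exact smul_right_injective _ hr0 (congrArg Subtype.val hxy)).trans (finrank_span_le_card {1})
    rw [NumberField.RingOfIntegers.rank, hdeg] at h2
    simp at h2
  rw [hr0, Ideal.mem_span_singleton] at hr
  exact isUnit_of_dvd_unit hr (by simp)

lemma dvd_of_intCast_mul_eq {a b : ℤ} (ha : a ≠ 0) {u : NumberField.RingOfIntegers K}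
    (h : (a : NumberField.RingOfIntegers K) * u = b) : a ∣ b := by
  have hu : algebraMap ℚ K (b / a) = u := by
    have := congrArg (algebraMap (NumberField.RingOfIntegers K) K) h
    simp only [map_mul, map_intCast] at this
    have ha' : (a : K) ≠ 0 := Int.cast_ne_zero.2 ha
    rw [map_div₀, map_intCast, map_intCast, ← this, mul_div_cancel_left₀ _ ha']
  have hi : IsIntegral ℤ (algebraMap ℚ K (b / a)) := hu ▸ u.isIntegral_coe
  rw [isIntegral_algebraMap_iff (algebraMap ℚ K).injective,
    IsIntegrallyClosed.isIntegral_iff] at hi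
  obtain ⟨q, hq⟩ := hi
  have ha' : (a : ℚ) ≠ 0 := Int.cast_ne_zero.2 ha
  rw [eq_div_iff ha', eq_intCast] at hq
  exact ⟨q, by rw [mul_comm]; exact_mod_cast hq.symm⟩

/-- The conductor of `ℤ + f·d·O_K` in `ℤ + f·O_K` is contained in `d·(ℤ + f·O_K)`. -/
lemma exists_mul_of_forall_mul_mem_orderSet (hdeg : Module.finrank ℚ K = 2) {f d : ℕ}
    (hf : 0 < f) (hd : 0 < d) {z : K}
    (hz : ∀ w ∈ orderSet K f, z * w ∈ orderSet K (f * d)) :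
    ∃ w ∈ orderSet K f, z = d * w := by
  obtain ⟨n, y, hy⟩ := hz 1 ⟨1, 0, by simp⟩
  rw [mul_one] at hy
  suffices hdn : (d : ℤ) ∣ n by
    obtain ⟨q, rfl⟩ := hdn
    refine ⟨q + f * algebraMap _ K y, ⟨q, y, rfl⟩, ?_⟩
    rw [hy]; push_cast; ring
  have hn : ∀ u : NumberField.RingOfIntegers K, ∃ (m : ℤ) (v : NumberField.RingOfIntegers K),
      (n * f * u : NumberField.RingOfIntegers K) = m + (f * d) * v := by
    intro u
    obtain ⟨m, v, hv⟩ := hz (f * algebraMap _ K u) ⟨0, u, by simp⟩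
    refine ⟨m, v - f * y * u, ?_⟩
    apply NumberField.RingOfIntegers.coe_injective
    rw [hy] at hv
    simp only [map_add, map_sub, map_mul, map_intCast, map_natCast]
    push_cast at hv
    linear_combination hv
  obtain ⟨g, r, s, hgn, ⟨h, hh⟩, hb⟩ : ∃ g r s : ℤ, g ∣ n ∧ g ∣ d ∧ g = n * r + d * s :=
    ⟨Int.gcd n d, _, _, Int.gcd_dvd_left .., Int.gcd_dvd_right .., Int.gcd_eq_gcd_ab n d⟩
  have hg0 : g ≠ 0 := by rintro h0; rw [h0] at hh; simp at hh; omega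
  have hfg0 : (f : ℤ) * g ≠ 0 := mul_ne_zero (by positivity) hg0
  have hu : IsUnit h := by
    refine isUnit_of_forall_eq_add_mul hdeg h fun u => ?_
    obtain ⟨m, v, hv⟩ := hn u
    have hgK : (g : NumberField.RingOfIntegers K) = n * r + d * s := by exact_mod_cast hb
    have hhK : (d : NumberField.RingOfIntegers K) = g * h := by exact_mod_cast hh
    have key : ((f * g : ℤ) : NumberField.RingOfIntegers K) * (u - h * (r * v + s * u))
        = ((r * m : ℤ) : NumberField.RingOfIntegers K) := by
      push_cast
      linear_combination r * hv + f * u * hgK + (f * r * v + f * s * u) * hhK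
    obtain ⟨m', hm'⟩ := dvd_of_intCast_mul_eq hfg0 key
    refine ⟨m', r * v + s * u, ?_⟩
    rw [hm', Int.cast_mul _ m'] at key
    have := mul_left_cancel₀ (Int.cast_ne_zero.2 hfg0) key
    linear_combination this
  rw [hh]
  exact hu.mul_right_dvd.2 hgn

lemma mul_mem_of_mem_orderSet {L : Submodule ℤ K} {c : ℕ} (hc : HasCond K L c) {z x : K}
    (hz : z ∈ orderSet K c) (hx : x ∈ L) : z * x ∈ L := by
  rw [← hc.2] at hz
  exact hz x hx

lemma mul_mem_invLat {L : Submodule ℤ K} {c : ℕ} (hc : HasCond K L c) {z x : K}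
    (hz : z ∈ orderSet K c) (hx : x ∈ invLat K L) : z * x ∈ invLat K L := by
  rw [← hc.2] at hz
  intro y hy w hw
  rw [mul_assoc, mul_assoc]
  apply hz
  rw [← mul_assoc]
  exact hx y hy w hw

/-- `O_{gcd(c, c')} ⊆ O_c + O_{c'}`. -/
lemma exists_add_of_mem_orderSet_gcd {c c' : ℕ} {z : K} (hz : z ∈ orderSet K (Nat.gcd c c')) :
    ∃ p ∈ orderSet K c, ∃ q ∈ orderSet K c', z = p + q := by
  obtain ⟨a, y, rfl⟩ := hz
  refine ⟨a + c * algebraMap _ K (Nat.gcdA c c' * y), ⟨a, Nat.gcdA c c' * y, rfl⟩,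
    c' * algebraMap _ K (Nat.gcdB c c' * y), ⟨0, Nat.gcdB c c' * y, by simp⟩, ?_⟩
  have := congrArg (Int.cast : ℤ → K) (Nat.gcd_eq_gcd_ab c c')
  push_cast at this
  simp only [map_mul, map_intCast]
  rw [this]
  ring

lemma mem_invLat_smul_iff {L : Submodule ℤ K} {f : K} (hf : f ≠ 0) {x : K} :
    x ∈ invLat K (f • L) ↔ f * x ∈ invLat K L := by
  have hm : ∀ z, z ∈ multLat K (f • L) ↔ z ∈ multLat K L := by
    intro z
    refine ⟨fun h y hy => ?_, fun h y hy => ?_⟩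
    · obtain ⟨w, hw, e⟩ := (Submodule.mem_smul_pointwise_iff_exists _ _ _).1
        (h (f * y) (Submodule.smul_mem_pointwise_smul y f L hy))
      rw [smul_eq_mul] at e
      have : w = z * y := mul_left_cancel₀ hf (by linear_combination e)
      rwa [← this]
    · obtain ⟨w, hw, rfl⟩ := (Submodule.mem_smul_pointwise_iff_exists _ _ _).1 hy
      rw [mul_smul_comm]
      exact Submodule.smul_mem_pointwise_smul _ f L (h w hw)
  refine ⟨fun h y hy => ?_, fun h y hy => ?_⟩
  · rw [← hm, mul_comm f, mul_assoc]
    exact h _ (Submodule.smul_mem_pointwise_smul y f L hy)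
  · obtain ⟨w, hw, rfl⟩ := (Submodule.mem_smul_pointwise_iff_exists _ _ _).1 hy
    rw [hm, smul_eq_mul, ← mul_assoc, mul_comm x]
    exact h w hw

/-- The colon lattice `(𝔞 : 𝔞')` equals `c·𝔞·(gcd(c, c')·𝔞')⁻¹`. -/
lemma forall_mul_mem_iff_mem_mul_invLat (hdeg : Module.finrank ℚ K = 2)
    {𝔞 𝔞' : Submodule ℤ K} (h𝔞 : IsLat K 𝔞) (h𝔞' : IsLat K 𝔞')
    {c c' : ℕ} (hc : HasCond K 𝔞 c) (hc' : HasCond K 𝔞' c') {x : K} :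
    (∀ y ∈ 𝔞', x * y ∈ 𝔞) ↔ x ∈ ((c : K) • 𝔞) * invLat K ((Nat.gcd c c' : K) • 𝔞') := by
  have hf : 0 < Nat.gcd c c' := Nat.gcd_pos_of_pos_left _ hc.1
  have hfK : (Nat.gcd c c' : K) ≠ 0 := by exact_mod_cast hf.ne'
  obtain ⟨d, hd⟩ := Nat.gcd_dvd_left c c'
  obtain ⟨d', hd'⟩ := Nat.gcd_dvd_right c c'
  have hdK : (c : K) = Nat.gcd c c' * d := by exact_mod_cast hd
  have hdK' : (c' : K) = Nat.gcd c c' * d' := by exact_mod_cast hd'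
  have hd0 : 0 < d := Nat.pos_of_ne_zero fun h => by
    have := hc.1
    rw [h, mul_zero] at hd
    omega
  constructor
  · intro hx
    have hO : ∀ y ∈ 𝔞', ∀ w ∈ orderSet K (Nat.gcd c c'), w * (x * y) ∈ 𝔞 := by
      intro y hy w hw
      obtain ⟨p, hp, q, hq, rfl⟩ := exists_add_of_mem_orderSet_gcd hw
      rw [add_mul]
      refine 𝔞.add_mem (mul_mem_of_mem_orderSet hc hp (hx y hy)) ?_
      rw [mul_left_comm]
      exact hx _ (mul_mem_of_mem_orderSet hc' hq hy)
    have hcol : ∀ y ∈ 𝔞', ∀ b ∈ invLat K 𝔞, ∃ w ∈ orderSet K (Nat.gcd c c'),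
        x * y * b = d * w := by
      intro y hy b hb
      refine exists_mul_of_forall_mul_mem_orderSet hdeg hf hd0 fun w hw => ?_
      rw [← hd, ← hc.2, show x * y * b * w = b * (w * (x * y)) by ring]
      exact hb _ (hO y hy w hw)
    have hterm : ∀ y ∈ 𝔞', ∀ b' ∈ invLat K 𝔞', ∀ a ∈ 𝔞, ∀ b ∈ invLat K 𝔞,
        x * (y * b') * (a * b) ∈ ((c : K) • 𝔞) * invLat K ((Nat.gcd c c' : K) • 𝔞') := by
      intro y hy b' hb' a ha b hb
      obtain ⟨w, hw, e⟩ := hcol y hy b hb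
      obtain ⟨p, hp, q, hq, rfl⟩ := exists_add_of_mem_orderSet_gcd hw
      have e2 : x * (y * b') * (a * b) =
          ((c : K) • (p * a)) * (b' / Nat.gcd c c') + ((c : K) • a) * (q * b' / Nat.gcd c c') := by
        rw [smul_eq_mul, smul_eq_mul, hdK]
        field_simp
        linear_combination a * b' * e
      rw [e2]
      refine Submodule.add_mem _ (Submodule.mul_mem_mul ?_ ?_) (Submodule.mul_mem_mul ?_ ?_)
      · exact Submodule.smul_mem_pointwise_smul _ _ _ (mul_mem_of_mem_orderSet hc hp ha)
      · rwa [mem_invLat_smul_iff hfK, mul_div_cancel₀ _ hfK]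
      · exact Submodule.smul_mem_pointwise_smul _ _ _ ha
      · rw [mem_invLat_smul_iff hfK, mul_div_cancel₀ _ hfK]
        exact mul_mem_invLat hc' hq hb'
    have h1 : ∀ r ∈ 𝔞' * invLat K 𝔞', ∀ s ∈ 𝔞 * invLat K 𝔞,
        x * r * s ∈ ((c : K) • 𝔞) * invLat K ((Nat.gcd c c' : K) • 𝔞') := by
      intro r hr s hs
      induction hr using Submodule.mul_induction_on' with
      | mem_mul_mem y hy b' hb' =>
        induction hs using Submodule.mul_induction_on' with
        | mem_mul_mem a ha b hb => exact hterm y hy b' hb' a ha b hb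
        | add s _ t _ hs ht => rw [mul_add]; exact Submodule.add_mem _ hs ht
      | add r _ t _ hr ht => rw [mul_add, add_mul]; exact Submodule.add_mem _ hr ht
    simpa using h1 1 (h𝔞'.one_mem_mul_invLat hdeg) 1 (h𝔞.one_mem_mul_invLat hdeg)
  · intro hx y hy
    induction hx using Submodule.mul_induction_on' with
    | mem_mul_mem p hp b hb =>
      obtain ⟨a, ha, rfl⟩ := (Submodule.mem_smul_pointwise_iff_exists _ _ _).1 hp
      rw [mem_invLat_smul_iff hfK] at hb
      have hby : Nat.gcd c c' * b * y ∈ (multLat K 𝔞' : Set K) := hb y hy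
      rw [hc'.2] at hby
      obtain ⟨n, v, e⟩ := hby
      have e2 : (c : K) • a * b * y = ((d * n : ℤ) + c * algebraMap _ K (d' * v)) * a := by
        rw [smul_eq_mul]
        push_cast
        rw [hdK'] at e
        rw [hdK]
        linear_combination (d * a) * e
      rw [e2]
      exact mul_mem_of_mem_orderSet hc ⟨_, _, rfl⟩ ha
    | add p _ q _ hp hq => rw [add_mul]; exact 𝔞.add_mem hp hq

lemma mem_latPair {A B : Submodule ℤ K} {v : Fin 2 → K} :
    v ∈ latPair K A B ↔ v 0 ∈ A ∧ v 1 ∈ B := Iff.rfl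

lemma exists_quadratic_of_mem_orderSet (hdeg : Module.finrank ℚ K = 2) {c c' : ℕ} {x y : K}
    (hx : x ∈ orderSet K c) (hy : y ∈ orderSet K c') :
    ∃ s n : ℤ, (x + y) ^ 2 - s * (x + y) + n = 0 := by
  obtain ⟨a, u, rfl⟩ := hx
  obtain ⟨b, v, rfl⟩ := hy
  obtain ⟨s, n, h⟩ := exists_quadratic_of_integer hdeg (a + c * u + (b + c' * v))
  refine ⟨s, n, ?_⟩
  have := congrArg (algebraMap (NumberField.RingOfIntegers K) K) h
  simpa using this

/-- A `2 × 2` matrix of determinant `±1` and integral trace that maps a lattice into itself maps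
it onto itself. -/
lemma exists_mulVec_eq_of_mapsTo {γ : Matrix (Fin 2) (Fin 2) K} (hγ : γ.det = 1 ∨ γ.det = -1)
    {s n : ℤ} (ht : (γ 0 0 + γ 1 1) ^ 2 - s * (γ 0 0 + γ 1 1) + n = 0)
    {Λ : Submodule ℤ (Fin 2 → K)} (hΛ : ∀ v ∈ Λ, γ.mulVec v ∈ Λ) {v : Fin 2 → K} (hv : v ∈ Λ) :
    ∃ w ∈ Λ, γ.mulVec w = v := by
  obtain ⟨d, hd, hd2⟩ : ∃ d : ℤ, γ.det = d ∧ d * d = 1 := by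
    rcases hγ with h | h
    · exact ⟨1, by simp [h]⟩
    · exact ⟨-1, by simp [h]⟩
  have hd2' : (d : K) * d = 1 := by exact_mod_cast hd2
  set t := γ 0 0 + γ 1 1 with htdef
  have hsq : ∀ v, γ.mulVec (γ.mulVec v) = t • γ.mulVec v - (d : K) • v := by
    intro v
    rw [← hd, Matrix.det_fin_two, htdef]
    ext i
    fin_cases i <;> simp [Matrix.mulVec, dotProduct, Fin.sum_univ_two] <;> ring
  set v1 := γ.mulVec v with h1
  set v2 := γ.mulVec v1 with h2
  set v3 := γ.mulVec v2 with h3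
  have m1 : v1 ∈ Λ := hΛ _ hv
  have m2 : v2 ∈ Λ := hΛ _ m1
  have m3 : v3 ∈ Λ := hΛ _ m2
  refine ⟨-(v3 - s • v2 + (2 * d + n) • v1 - (d * s) • v), Λ.neg_mem (Λ.sub_mem (Λ.add_mem
    (Λ.sub_mem m3 (Λ.smul_mem _ m2)) (Λ.smul_mem _ m1)) (Λ.smul_mem _ hv)), ?_⟩
  rw [Matrix.mulVec_neg, Matrix.mulVec_sub, Matrix.mulVec_add, Matrix.mulVec_sub,
    Matrix.mulVec_smul, Matrix.mulVec_smul, Matrix.mulVec_smul, ← h1, ← h2, ← h3]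
  have e0 : v2 = t • v1 - (d : K) • v := hsq v
  have e1 : v3 = t • v2 - (d : K) • v1 := hsq v1
  have e2 : γ.mulVec v3 = t • v3 - (d : K) • v2 := hsq v2
  ext i
  have e0 := congrFun e0 i
  have e1 := congrFun e1 i
  have e2 := congrFun e2 i
  simp only [Pi.sub_apply, Pi.smul_apply, smul_eq_mul, Pi.neg_apply, Pi.add_apply] at e0 e1 e2 ⊢
  simp only [zsmul_eq_mul]
  push_cast
  linear_combination -e2 + (s - t) * e1 - d * e0 - v2 i * ht + v i * hd2'

variable (K)

/-- A determinant-`±1` matrix `γ ∈ GL₂(K)` stabilizes the lattice `𝔞 ⊕ 𝔞′` if and only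
if `γ₁₁ ∈ O_c`, `γ₂₂ ∈ O_{c′}`, `γ₁₂ ∈ c·𝔞·(f′·𝔞′)⁻¹` and `γ₂₁ ∈ c′·𝔞′·(f′·𝔞)⁻¹`,
where `c, c′` are the conductors of `𝔞, 𝔞′` and `f′ = gcd(c, c′)`. -/
theorem stabilizer_eq_gamma
    (hdeg : Module.finrank ℚ K = 2)
    (himag : IsEmpty (K →+* ℝ))
    (𝔞 𝔞' : Submodule ℤ K) (h𝔞 : IsLat K 𝔞) (h𝔞' : IsLat K 𝔞')
    (c c' : ℕ) (hc : HasCond K 𝔞 c) (hc' : HasCond K 𝔞' c')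
    (f' : ℕ) (hf' : f' = Nat.gcd c c')
    (γ : Matrix (Fin 2) (Fin 2) K) (hγ : γ.det = 1 ∨ γ.det = -1) :
    Submodule.map ((Matrix.mulVecLin γ).restrictScalars ℤ) (latPair K 𝔞 𝔞') =
        latPair K 𝔞 𝔞' ↔
      (γ 0 0 ∈ orderSet K c ∧ γ 1 1 ∈ orderSet K c' ∧
        γ 0 1 ∈ ((c : K) • 𝔞) * invLat K ((f' : K) • 𝔞') ∧
        γ 1 0 ∈ ((c' : K) • 𝔞') * invLat K ((f' : K) • 𝔞)) := by
  subst hf'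
  have h01 := forall_mul_mem_iff_mem_mul_invLat hdeg h𝔞 h𝔞' hc hc' (x := γ 0 1)
  have h10 := forall_mul_mem_iff_mem_mul_invLat hdeg h𝔞' h𝔞 hc' hc (x := γ 1 0)
  rw [Nat.gcd_comm c' c] at h10
  rw [← h01, ← h10, ← hc.2, ← hc'.2]
  have hmul : ∀ v, γ.mulVec v 0 = γ 0 0 * v 0 + γ 0 1 * v 1 ∧
      γ.mulVec v 1 = γ 1 0 * v 0 + γ 1 1 * v 1 := fun v => by
    simp [Matrix.mulVec, dotProduct, Fin.sum_univ_two]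
  constructor
  · intro h
    have hΛ : ∀ v ∈ latPair K 𝔞 𝔞', γ.mulVec v ∈ latPair K 𝔞 𝔞' := fun v hv => by
      have hv' := Submodule.mem_map_of_mem (f := (Matrix.mulVecLin γ).restrictScalars ℤ) hv
      rwa [h] at hv'
    have hl : ∀ x ∈ 𝔞, γ 0 0 * x ∈ 𝔞 ∧ γ 1 0 * x ∈ 𝔞' := fun x hx => by
      simpa [mem_latPair, hmul] using hΛ ![x, 0] (by simp [mem_latPair, hx])
    have hr : ∀ x ∈ 𝔞', γ 0 1 * x ∈ 𝔞 ∧ γ 1 1 * x ∈ 𝔞' := fun x hx => by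
      simpa [mem_latPair, hmul] using hΛ ![0, x] (by simp [mem_latPair, hx])
    exact ⟨fun x hx => (hl x hx).1, fun x hx => (hr x hx).2, fun x hx => (hr x hx).1,
      fun x hx => (hl x hx).2⟩
  · rintro ⟨h00, h11, h01, h10⟩
    have hΛ : ∀ v ∈ latPair K 𝔞 𝔞', γ.mulVec v ∈ latPair K 𝔞 𝔞' := by
      rintro v ⟨hv0, hv1⟩
      rw [mem_latPair, (hmul v).1, (hmul v).2]
      exact ⟨𝔞.add_mem (h00 _ hv0) (h01 _ hv1), 𝔞'.add_mem (h10 _ hv0) (h11 _ hv1)⟩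
    rw [hc.2] at h00
    rw [hc'.2] at h11
    obtain ⟨s, n, ht⟩ := exists_quadratic_of_mem_orderSet hdeg h00 h11
    apply le_antisymm
    · rintro _ ⟨v, hv, rfl⟩
      exact hΛ v hv
    · intro v hv
      exact exists_mulVec_eq_of_mapsTo hγ ht hΛ hv

end
end

section
/- Let K be an imaginary quadratic field and let 𝔞, 𝔞′ be rank-1 K-lattices of conductors c and c′ respectively, and set f = lcm(c, c′). Then there exists γ ∈ GL₂(K) such that γ·(𝔞 ⊕ 𝔞′) = O_f ⊕ (𝔞·𝔞′), where 𝔞·𝔞′ is the product lattice. -/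
open scoped Pointwise

noncomputable section

variable (K : Type) [Field K] [NumberField K]

/-- The order `ℤ + m·O_K` of conductor `m`, as a `ℤ`-submodule of `K`. -/
def orderLat (m : ℕ) : Submodule ℤ K where
  carrier := orderSet K m
  add_mem' := by
    rintro x y ⟨a, u, rfl⟩ ⟨b, v, rfl⟩
    exact ⟨a + b, u + v, by rw [map_add]; push_cast; ring⟩
  zero_mem' := ⟨0, 0, by simp⟩
  smul_mem' := by
    rintro n x ⟨a, u, rfl⟩
    refine ⟨n * a, n • u, ?_⟩
    rw [map_zsmul, zsmul_eq_mul, zsmul_eq_mul]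
    push_cast
    ring

/-- A primitive binary quadratic form represents an integer coprime to a given `n ≠ 0`. -/
theorem exists_isCoprime_quadratic (A B C : ℤ)
    (h : ∀ p : ℕ, p.Prime → (p : ℤ) ∣ A → (p : ℤ) ∣ B → ¬ (p : ℤ) ∣ C) (n : ℕ) (hn : n ≠ 0) :
    ∃ u v : ℤ, IsCoprime (A * u ^ 2 - B * u * v + C * v ^ 2) (n : ℤ) := by
  classical
  have exists_prod (P : ℕ → Prop) : ∃ u : ℤ, ∀ p ∈ n.primeFactors, (p : ℤ) ∣ u ↔ P p := by
    refine ⟨((∏ q ∈ n.primeFactors with P q, q : ℕ) : ℤ), fun p hp => ?_⟩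
    have pp := Nat.prime_of_mem_primeFactors hp
    rw [Int.natCast_dvd_natCast, pp.prime.dvd_finsetProd_iff]
    constructor
    · rintro ⟨q, hq, hpq⟩
      rw [Finset.mem_filter] at hq
      rw [(Nat.prime_dvd_prime_iff_eq pp (Nat.prime_of_mem_primeFactors hq.1)).1 hpq]
      exact hq.2
    · exact fun hP => ⟨p, Finset.mem_filter.2 ⟨hp, hP⟩, dvd_rfl⟩
  obtain ⟨u, hu⟩ := exists_prod (fun p => (p : ℤ) ∣ A ∧ ¬ (p : ℤ) ∣ C)
  obtain ⟨v, hv⟩ := exists_prod (fun p => ¬ (p : ℤ) ∣ A)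
  refine ⟨u, v, ?_⟩
  rw [Int.isCoprime_iff_gcd_eq_one, Int.gcd_eq_natAbs, Int.natAbs_natCast]
  refine Nat.Coprime.symm (Nat.coprime_of_dvd fun p pp hpn hpq => ?_)
  have hp : p ∈ n.primeFactors := Nat.mem_primeFactors.2 ⟨pp, hpn, hn⟩
  have pZ : Prime (p : ℤ) := Nat.prime_iff_prime_int.1 pp
  rw [← Int.natCast_dvd] at hpq
  specialize hu p hp
  specialize hv p hp
  by_cases hA : (p : ℤ) ∣ A
  · have hv' : ¬ (p : ℤ) ∣ v := fun hh => hv.1 hh hA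
    by_cases hC : (p : ℤ) ∣ C
    · have hu' : ¬ (p : ℤ) ∣ u := fun hh => (hu.1 hh).2 hC
      have hBuv : (p : ℤ) ∣ B * u * v := by
        have := ((hA.mul_right (u ^ 2)).add (hC.mul_right (v ^ 2))).sub hpq
        ring_nf at this ⊢
        exact this
      rcases pZ.dvd_or_dvd hBuv with h1 | h1
      · rcases pZ.dvd_or_dvd h1 with h2 | h2
        · exact h p pp hA h2 hC
        · exact hu' h2
      · exact hv' h1
    · have hu' : (p : ℤ) ∣ u := hu.2 ⟨hA, hC⟩
      have hCv : (p : ℤ) ∣ C * v ^ 2 := by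
        have := hpq.sub (hu'.mul_right (A * u - B * v))
        ring_nf at this ⊢
        exact this
      rcases pZ.dvd_or_dvd hCv with h1 | h1
      · exact hC h1
      · exact hv' (pZ.dvd_of_dvd_pow h1)
  · have hv' : (p : ℤ) ∣ v := hv.2 hA
    have hAu : (p : ℤ) ∣ A * u ^ 2 := by
      have := hpq.sub (hv'.mul_right (C * v - B * u))
      ring_nf at this ⊢
      exact this
    rcases pZ.dvd_or_dvd hAu with h1 | h1
    · exact hA h1
    · exact hA (hu.1 (pZ.dvd_of_dvd_pow h1)).1

variable {K}

/-- An element of a quadratic field is a root of a primitive integral quadratic polynomial. -/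
theorem exists_primitive_relation (hdeg : Module.finrank ℚ K = 2) (τ : K) :
    ∃ A B C : ℤ, (A : K) * τ ^ 2 + B * τ + C = 0 ∧
      ∀ p : ℕ, p.Prime → (p : ℤ) ∣ A → (p : ℤ) ∣ B → ¬ (p : ℤ) ∣ C := by
  have hdep : ¬ LinearIndependent ℤ (fun i : Fin 3 => τ ^ (i : ℕ)) := by
    rw [LinearIndependent.iff_fractionRing ℤ ℚ]
    intro hli
    have := hli.fintype_card_le_finrank
    simp [hdeg] at this
  obtain ⟨g, hg, i, hi⟩ := Fintype.not_linearIndependent_iff.1 hdep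
  have hd : (Finset.univ : Finset (Fin 3)).gcd g ≠ 0 := fun h0 =>
    hi (Finset.gcd_eq_zero_iff.1 h0 i (Finset.mem_univ i))
  obtain ⟨b, hb, hb1⟩ := Finset.extract_gcd g (Finset.univ_nonempty (α := Fin 3))
  refine ⟨b 2, b 1, b 0, ?_, fun p pp h2 h1 h0 => ?_⟩
  · have hdK : (((Finset.univ : Finset (Fin 3)).gcd g : ℤ) : K) ≠ 0 := Int.cast_ne_zero.2 hd
    apply mul_left_cancel₀ hdK
    simp only [zsmul_eq_mul, Fin.sum_univ_three] at hg
    rw [hb 0 (Finset.mem_univ _), hb 1 (Finset.mem_univ _), hb 2 (Finset.mem_univ _)] at hg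
    push_cast at hg
    simp only [Fin.val_zero, Fin.val_one, Fin.val_two] at hg
    linear_combination hg
  · have : (p : ℤ) ∣ (Finset.univ : Finset (Fin 3)).gcd b :=
      Finset.dvd_gcd fun j _ => by fin_cases j <;> assumption
    rw [hb1] at this
    exact (Nat.prime_iff_prime_int.1 pp).not_isUnit (isUnit_of_dvd_one this)

theorem IsLat.exists_basis (hdeg : Module.finrank ℚ K = 2) {L : Submodule ℤ K} (hL : IsLat K L) :
    ∃ w₁ w₂ : K, w₁ ≠ 0 ∧ ∀ x, x ∈ L ↔ ∃ r s : ℤ, x = r * w₁ + s * w₂ := by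
  have : Submodule.IsLattice ℚ L := ⟨hL.1, hL.2⟩
  have hfree : Module.Free ℤ L := Submodule.IsLattice.free ℚ L
  have hfin : Module.Finite ℤ L := Module.Finite.iff_fg.2 hL.1
  have hrank : Module.finrank ℤ L = 2 := by
    rw [Module.finrank, Submodule.IsLattice.rank' ℚ L, ← hdeg, Module.finrank]
  let b := Module.finBasisOfFinrankEq ℤ L hrank
  refine ⟨b 0, b 1, fun h0 => b.ne_zero 0 (Subtype.ext h0), fun x => ⟨fun hx => ?_, ?_⟩⟩
  · refine ⟨b.repr ⟨x, hx⟩ 0, b.repr ⟨x, hx⟩ 1, ?_⟩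
    have := congrArg Subtype.val (b.sum_repr ⟨x, hx⟩)
    simp only [Fin.sum_univ_two, Submodule.coe_add, Submodule.coe_smul, zsmul_eq_mul] at this
    exact this.symm
  · rintro ⟨r, s, rfl⟩
    rw [← zsmul_eq_mul, ← zsmul_eq_mul]
    exact L.add_mem (L.smul_mem r (b 0).2) (L.smul_mem s (b 1).2)

/-- A lattice of conductor `c` can be scaled into `O_c` so as to contain an integer coprime
to `n`. -/
theorem HasCond.exists_scaling (hdeg : Module.finrank ℚ K = 2) {L : Submodule ℤ K}
    (hL : IsLat K L) {c : ℕ} (hc : HasCond K L c) (n : ℕ) (hn : n ≠ 0) :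
    ∃ (a : K) (N : ℤ), IsCoprime N (n : ℤ) ∧ (∀ x ∈ L, a * x ∈ orderLat K c) ∧
      ∃ x ∈ L, a * x = N := by
  obtain ⟨w₁, w₂, hw, hmem⟩ := hL.exists_basis hdeg
  obtain ⟨A, B, C, hrel, hprim⟩ := exists_primitive_relation hdeg (w₂ / w₁)
  obtain ⟨u, v, huv⟩ := exists_isCoprime_quadratic A B C hprim n hn
  have hrel' : (A : K) * w₂ ^ 2 + B * w₂ * w₁ + C * w₁ ^ 2 = 0 := by
    field_simp at hrel
    linear_combination hrel
  have hint (k : ℤ) : (k : K) ∈ orderLat K c := ⟨k, 0, by simp⟩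
  have hAτ : (A : K) * (w₂ / w₁) ∈ orderLat K c := by
    change _ ∈ orderSet K c
    rw [← hc.2]
    intro x hx
    obtain ⟨r, s, rfl⟩ := (hmem x).1 hx
    refine (hmem _).2 ⟨-(s * C), r * A - s * B, ?_⟩
    push_cast
    field_simp
    linear_combination (s : K) * hrel'
  have hsmul (k : ℤ) : (k : K) * (A * (w₂ / w₁)) ∈ orderLat K c := by
    rw [← zsmul_eq_mul]
    exact (orderLat K c).smul_mem k hAτ
  refine ⟨(A * u - B * v - v * (A * (w₂ / w₁))) / w₁, _, huv, fun x hx => ?_,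
    u * w₁ + v * w₂, (hmem _).2 ⟨u, v, rfl⟩, ?_⟩
  · obtain ⟨r, s, rfl⟩ := (hmem x).1 hx
    have := (orderLat K c).add_mem (hint (r * (A * u - B * v) + s * (v * C)))
      (hsmul (s * u - r * v))
    convert this using 1
    push_cast
    field_simp
    linear_combination (-(s : K) * v) * hrel'
  · push_cast
    field_simp
    linear_combination (-(v : K) ^ 2) * hrel'

theorem natCast_mul_mem_orderLat {m c f : ℕ} (hf : f = c * m) {x : K} (hx : x ∈ orderLat K c) :
    (m : K) * x ∈ orderLat K f := by
  obtain ⟨k, y, rfl⟩ := hx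
  refine ⟨m * k, y, ?_⟩
  rw [hf]
  push_cast
  ring

theorem HasCond.mul_mem {L : Submodule ℤ K} {c f : ℕ} (hc : HasCond K L c) (hcf : c ∣ f)
    {s x : K} (hs : s ∈ orderLat K f) (hx : x ∈ L) : s * x ∈ L := by
  have hs' : s ∈ orderSet K c := by
    obtain ⟨d, rfl⟩ := hcf
    obtain ⟨k, y, rfl⟩ := hs
    refine ⟨k, d * y, ?_⟩
    simp only [map_mul, map_natCast]
    push_cast
    ring
  rw [← hc.2] at hs'
  exact hs' x hx

/-- Scalings of two lattices into `O_f` that are comaximal there. -/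
theorem exists_comaximal_scalings (hdeg : Module.finrank ℚ K = 2) {L L' : Submodule ℤ K}
    (hL : IsLat K L) (hL' : IsLat K L') {c c' : ℕ} (hc : HasCond K L c) (hc' : HasCond K L' c') :
    ∃ α β : K, (∀ x ∈ L, α * x ∈ orderLat K (Nat.lcm c c')) ∧
      (∀ y ∈ L', β * y ∈ orderLat K (Nat.lcm c c')) ∧
      ∃ x ∈ L, ∃ y ∈ L', α * x + β * y = 1 := by
  obtain ⟨m, m', hcop, hm, hm'⟩ := Nat.exists_coprime c c'
  set g := Nat.gcd c c'
  have hm0 : m ≠ 0 := by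
    rintro rfl
    exact hc.1.ne' (by simpa using hm)
  have hm0' : m' ≠ 0 := by
    rintro rfl
    exact hc'.1.ne' (by simpa using hm')
  have hlcm : Nat.lcm c c' = m * m' * g := by
    rw [hm, hm', Nat.lcm_mul_right, hcop.lcm_eq_mul]
  obtain ⟨a, N, hN, ha, x, hx, hax⟩ := hc.exists_scaling hdeg hL (2 * m) (by positivity)
  have hN0 : N ≠ 0 := by
    rintro rfl
    rw [isCoprime_zero_left, Int.isUnit_iff] at hN
    omega
  obtain ⟨b, N', hN', hb, y, hy, hby⟩ := hc'.exists_scaling hdeg hL' (m' * N.natAbs)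
    (mul_ne_zero hm0' (Int.natAbs_ne_zero.2 hN0))
  have h1 : IsCoprime (m' * N : ℤ) (m * N' : ℤ) := by
    push_cast at hN hN'
    have hcopZ : IsCoprime (m : ℤ) (m' : ℤ) := Nat.isCoprime_iff_coprime.2 hcop
    have hNN' : IsCoprime N' N :=
      hN'.of_mul_right_right.of_isCoprime_of_dvd_right (self_dvd_abs N)
    exact (hcopZ.symm.mul_right hN'.of_mul_right_left.symm).mul_left
      (hN.of_mul_right_right.mul_right hNN'.symm)
  obtain ⟨r, s, hrs⟩ := h1
  refine ⟨m' * a, m * b, fun z hz => ?_, fun z hz => ?_, r • x, L.smul_mem r hx, s • y,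
    L'.smul_mem s hy, ?_⟩
  · rw [mul_assoc]
    exact natCast_mul_mem_orderLat (by rw [hlcm, hm]; ring) (ha z hz)
  · rw [mul_assoc]
    exact natCast_mul_mem_orderLat (by rw [hlcm, hm']; ring) (hb z hz)
  · have hrs' : (r : K) * (m' * N) + s * (m * N') = 1 := by exact_mod_cast hrs
    rw [zsmul_eq_mul, zsmul_eq_mul]
    linear_combination hrs' + (r : K) * m' * hax + (s : K) * m * hby

variable (K)

/-- If `𝔞, 𝔞′` are rank-1 `K`-lattices of conductors `c, c′` and `f = lcm(c, c′)`, then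
some `γ ∈ GL₂(K)` carries `𝔞 ⊕ 𝔞′` to `O_f ⊕ (𝔞·𝔞′)`. -/
theorem pair_canonical_form
    (hdeg : Module.finrank ℚ K = 2)
    (himag : IsEmpty (K →+* ℝ))
    (𝔞 𝔞' : Submodule ℤ K) (h𝔞 : IsLat K 𝔞) (h𝔞' : IsLat K 𝔞')
    (c c' : ℕ) (hc : HasCond K 𝔞 c) (hc' : HasCond K 𝔞' c')
    (f : ℕ) (hf : f = Nat.lcm c c') :
    ∃ γ : Matrix (Fin 2) (Fin 2) K, IsUnit γ ∧
      Submodule.map ((Matrix.mulVecLin γ).restrictScalars ℤ) (latPair K 𝔞 𝔞') =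
        latPair K (orderLat K f) (𝔞 * 𝔞') := by
  subst hf
  obtain ⟨α, β, hα, hβ, x₀, hx₀, y₀, hy₀, h1⟩ := exists_comaximal_scalings hdeg h𝔞 h𝔞' hc hc'
  have hdvd := Nat.dvd_lcm_left c c'
  have hdvd' := Nat.dvd_lcm_right c c'
  have hβmul : ∀ t ∈ 𝔞 * 𝔞', β * t ∈ 𝔞 := fun t ht => by
    induction ht using Submodule.mul_induction_on' with
    | mem_mul_mem x hx y hy =>
      rw [show β * (x * y) = β * y * x by ring]
      exact hc.mul_mem hdvd (hβ y hy) hx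
    | add x _ y _ ihx ihy => rw [mul_add]; exact 𝔞.add_mem ihx ihy
  have hαmul : ∀ t ∈ 𝔞 * 𝔞', α * t ∈ 𝔞' := fun t ht => by
    induction ht using Submodule.mul_induction_on' with
    | mem_mul_mem x hx y hy =>
      rw [← mul_assoc]
      exact hc'.mul_mem hdvd' (hα x hx) hy
    | add x _ y _ ihx ihy => rw [mul_add]; exact 𝔞'.add_mem ihx ihy
  refine ⟨!![α, β; y₀, -x₀], ?_, ?_⟩
  · rw [Matrix.isUnit_iff_isUnit_det, Matrix.det_fin_two_of,
      show α * -x₀ - β * y₀ = -1 by linear_combination -h1]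
    exact isUnit_one.neg
  · ext w
    simp only [latPair, Submodule.mem_map, Submodule.mem_inf, Submodule.mem_comap,
      LinearMap.proj_apply, LinearMap.coe_restrictScalars, Matrix.mulVecLin_apply]
    constructor
    · rintro ⟨z, ⟨hz0, hz1⟩, rfl⟩
      simp only [Matrix.mulVec, dotProduct, Fin.sum_univ_two, Matrix.of_apply,
        Matrix.cons_val_zero, Matrix.cons_val_one, Matrix.cons_val', Matrix.cons_val_fin_one]
      refine ⟨Submodule.add_mem _ (hα _ hz0) (hβ _ hz1), ?_⟩
      rw [show y₀ * z 0 + -x₀ * z 1 = z 0 * y₀ - x₀ * z 1 by ring]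
      exact Submodule.sub_mem _ (Submodule.mul_mem_mul hz0 hy₀) (Submodule.mul_mem_mul hx₀ hz1)
    · rintro ⟨hs, ht⟩
      refine ⟨![w 0 * x₀ + β * w 1, w 0 * y₀ - α * w 1],
        ⟨𝔞.add_mem (hc.mul_mem hdvd hs hx₀) (hβmul _ ht),
          𝔞'.sub_mem (hc'.mul_mem hdvd' hs hy₀) (hαmul _ ht)⟩, ?_⟩
      ext i
      fin_cases i
      · simp [Matrix.mulVec, dotProduct, Fin.sum_univ_two]
        linear_combination w 0 * h1
      · simp [Matrix.mulVec, dotProduct, Fin.sum_univ_two]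
        linear_combination w 1 * h1

end
end

section
/- Let K be a quadratic number field (imaginary or real), let L₁ and L₂ be rank-1 K-lattices of conductors f₁ and f₂, and set f = lcm(f₁, f₂). For any positive integer F divisible by f, both L₁ and L₂ are modules over the order O_F, and there is an isomorphism of O_F-modules Ext¹_{O_F}(L₁, L₂) ≅ Hom_{O_F}(L₁, L₂) / ((F/f)·Hom_{O_F}(L₁, L₂)). -/
noncomputable section

variable (K : Type) [Field K] [NumberField K]

/-- The order `ℤ + m·O_K` of conductor `m`, as a subring of `K`. -/
def orderSubring (m : ℕ) : Subring K where
  carrier := orderSet K m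
  add_mem' := by
    rintro x y ⟨a, u, rfl⟩ ⟨b, v, rfl⟩
    exact ⟨a + b, u + v, by rw [map_add]; push_cast; ring⟩
  zero_mem' := ⟨0, 0, by simp⟩
  one_mem' := ⟨1, 0, by simp⟩
  neg_mem' := by
    rintro x ⟨a, u, rfl⟩
    exact ⟨-a, -u, by rw [map_neg]; push_cast; ring⟩
  mul_mem' := by
    rintro x y ⟨a, u, rfl⟩ ⟨b, v, rfl⟩
    refine ⟨a * b, a • v + b • u + (m : ℤ) • (u * v), ?_⟩
    rw [map_add, map_add, map_zsmul, map_zsmul, map_zsmul, map_mul]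
    rw [zsmul_eq_mul, zsmul_eq_mul, zsmul_eq_mul]
    push_cast
    ring

/-- A lattice `L` with `R·L ⊆ L` is a module over the subring `R ⊆ K`. -/
def latticeModule (R : Subring K) (L : Submodule ℤ K)
    (h : ∀ r ∈ R, ∀ x ∈ L, r * x ∈ L) : Module R L :=
  { smul := fun r x => ⟨(r : K) * (x : K), h r r.2 x x.2⟩
    one_smul := fun x => by ext; exact one_mul _
    mul_smul := fun r s x => by ext; exact mul_assoc _ _ _
    smul_zero := fun r => by ext; exact mul_zero _
    smul_add := fun r x y => by ext; exact mul_add _ _ _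
    add_smul := fun r s x => by ext; exact add_mul _ _ _
    zero_smul := fun x => by ext; exact zero_mul _ }

/-- The `R`-module `Ext¹_R(L₁, L₂)` for lattices `L₁, L₂` stable under the subring
`R ⊆ K`. -/
def extOrderObj (R : Subring K) (L₁ L₂ : Submodule ℤ K)
    (h₁ : ∀ r ∈ R, ∀ x ∈ L₁, r * x ∈ L₁)
    (h₂ : ∀ r ∈ R, ∀ x ∈ L₂, r * x ∈ L₂) : ModuleCat R := by
  letI := latticeModule K R L₁ h₁
  letI := latticeModule K R L₂ h₂
  exact ((Ext R (ModuleCat R) 1).obj (Opposite.op (ModuleCat.of R L₁))).obj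
    (ModuleCat.of R L₂)

/-- The `R`-module `Hom_R(L₁, L₂)/(k·Hom_R(L₁, L₂))`. -/
def homQuotObj (R : Subring K) (L₁ L₂ : Submodule ℤ K)
    (h₁ : ∀ r ∈ R, ∀ x ∈ L₁, r * x ∈ L₁)
    (h₂ : ∀ r ∈ R, ∀ x ∈ L₂, r * x ∈ L₂) (k : ℕ) : ModuleCat R := by
  letI := latticeModule K R L₁ h₁
  letI := latticeModule K R L₂ h₂
  exact ModuleCat.of R ((L₁ →ₗ[R] L₂) ⧸
    (LinearMap.range
      (k • (LinearMap.id : (L₁ →ₗ[R] L₂) →ₗ[R] (L₁ →ₗ[R] L₂)))))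

section

open CategoryTheory TensorProduct

section PeriodicResolution

variable {R : Type} [CommRing R] {M : Type} [AddCommGroup M] [Module R M]

/-- Multiplication by `τ` on a module, as a `ℤ`-linear map. -/
noncomputable def mulZ (M : Type) [AddCommGroup M] [Module R M] (τ : R) : M →ₗ[ℤ] M :=
  (LinearMap.lsmul R M τ).restrictScalars ℤ

@[simp] lemma mulZ_apply (τ : R) (x : M) : mulZ M τ x = τ • x := rfl

/-- The endomorphism `1 ⊗ τ - s ⊗ 1` of the `R`-module `R ⊗ M`. -/
noncomputable def tensorDiff (M : Type) [AddCommGroup M] [Module R M] (τ s : R) :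
    R ⊗[ℤ] M →ₗ[R] R ⊗[ℤ] M :=
  (mulZ M τ).baseChange R - LinearMap.lsmul R _ s

@[simp] lemma tensorDiff_tmul (τ s r : R) (x : M) :
    tensorDiff M τ s (r ⊗ₜ x) = r ⊗ₜ (τ • x) - (s * r) ⊗ₜ x := by
  simp [tensorDiff, TensorProduct.smul_tmul']

/-- The multiplication map `R ⊗ M → M`. -/
noncomputable def tensorAug (R M : Type) [CommRing R] [AddCommGroup M] [Module R M] :
    R ⊗[ℤ] M →ₗ[R] M :=
  (LinearMap.id : M →ₗ[ℤ] M).liftBaseChange R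

@[simp] lemma tensorAug_tmul (r : R) (x : M) : tensorAug R M (r ⊗ₜ x) = r • x := by
  simp [tensorAug]

omit [Module R M] in
lemma exists_tmul_add_tmul {s : R} (hs : ∀ r : R, ∃ a b : ℤ, r = a + b * s) (z : R ⊗[ℤ] M) :
    ∃ x y : M, z = (1 : R) ⊗ₜ x + s ⊗ₜ y := by
  induction z with
  | zero => exact ⟨0, 0, by simp⟩
  | tmul r m =>
    obtain ⟨a, b, rfl⟩ := hs r
    refine ⟨a • m, b • m, ?_⟩
    rw [← TensorProduct.smul_tmul, ← TensorProduct.smul_tmul, ← TensorProduct.add_tmul]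
    simp
  | add z w hz hw =>
    obtain ⟨x, y, rfl⟩ := hz
    obtain ⟨x', y', rfl⟩ := hw
    exact ⟨x + x', y + y', by simp only [TensorProduct.tmul_add]; abel⟩

omit [Module R M] in
lemma eq_zero_of_tmul_add_tmul_eq_zero {s : R} (c : R →ₗ[ℤ] ℤ) (h1 : c 1 = 0)
    (hs : c s = 1 ∨ c s = -1) {x y : M} (h : (1 : R) ⊗ₜ[ℤ] x + s ⊗ₜ y = 0) : y = 0 := by
  have := congrArg (TensorProduct.lift ((LinearMap.lsmul ℤ M).comp c)) h
  rcases hs with hs | hs <;> simpa [h1, hs] using this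

lemma tensorDiff_comp {τ s s' : R} (h : τ * τ - (s + s') * τ + s * s' = 0)
    (t : ℤ) (ht : s + s' = t) (n : ℤ) (hn : s * s' = n) (z : R ⊗[ℤ] M) :
    tensorDiff M τ s (tensorDiff M τ s' z) = 0 := by
  induction z with
  | zero => simp
  | add z w hz hw => simp [hz, hw]
  | tmul r m =>
    have h1 : τ • τ • m = t • τ • m - n • m := by
      rw [← Int.cast_smul_eq_zsmul R t, ← Int.cast_smul_eq_zsmul R n, ← ht, ← hn, smul_smul,
        smul_smul, ← sub_smul]
      congr 1
      linear_combination h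
    have h2 : (t • r) ⊗ₜ[ℤ] (τ • m) = r ⊗ₜ[ℤ] (t • τ • m) := TensorProduct.smul_tmul _ _ _
    have h3 : (n • r) ⊗ₜ[ℤ] m = r ⊗ₜ[ℤ] (n • m) := TensorProduct.smul_tmul _ _ _
    rw [tensorDiff_tmul, map_sub, tensorDiff_tmul, tensorDiff_tmul, h1, TensorProduct.tmul_sub,
      ← h2, ← h3, ← mul_assoc, hn, zsmul_eq_mul, zsmul_eq_mul, ← ht, add_mul,
      TensorProduct.add_tmul]
    abel

lemma exists_of_tensorDiff_eq_zero {τ s s' : R} (t : ℤ) (ht : s + s' = t) (n : ℤ) (hn : s * s' = n)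
    (hspan : ∀ r : R, ∃ a b : ℤ, r = a + b * s) (c : R →ₗ[ℤ] ℤ) (h1 : c 1 = 0)
    (hs : c s = 1 ∨ c s = -1) (z : R ⊗[ℤ] M) (hz : tensorDiff M τ s z = 0) :
    ∃ w, tensorDiff M τ s' w = z := by
  obtain ⟨x, y, rfl⟩ := exists_tmul_add_tmul hspan z
  refine ⟨1 ⊗ₜ y, ?_⟩
  have hss : s * s = t • s - n • (1 : R) := by
    rw [zsmul_eq_mul, zsmul_eq_mul, ← ht, ← hn]; ring
  have key : (1 : R) ⊗ₜ[ℤ] (τ • x + n • y) + s ⊗ₜ[ℤ] (τ • y - x - t • y) = 0 := by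
    rw [← hz, map_add, tensorDiff_tmul, tensorDiff_tmul, hss, TensorProduct.sub_tmul,
      TensorProduct.smul_tmul, TensorProduct.smul_tmul, TensorProduct.tmul_add,
      TensorProduct.tmul_sub, TensorProduct.tmul_sub, mul_one]
    abel
  have hx := eq_zero_of_tmul_add_tmul_eq_zero c h1 hs key
  have hx' : x = τ • y - t • y := by rw [← sub_eq_zero, ← neg_eq_zero, ← hx]; abel
  have hs' : s' = t • (1 : R) - s := by rw [zsmul_eq_mul, ← ht]; ring
  rw [tensorDiff_tmul, hx', mul_one, hs', TensorProduct.sub_tmul, TensorProduct.tmul_sub,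
    TensorProduct.smul_tmul]
  abel

lemma exists_of_tensorAug_eq_zero {τ : R} (hspan : ∀ r : R, ∃ a b : ℤ, r = a + b * τ)
    (z : R ⊗[ℤ] M) (hz : tensorAug R M z = 0) : ∃ w, tensorDiff M τ τ w = z := by
  obtain ⟨x, y, rfl⟩ := exists_tmul_add_tmul hspan z
  refine ⟨-(1 ⊗ₜ y), ?_⟩
  have hx : x = -(τ • y) := by
    rw [eq_neg_iff_add_eq_zero]; simpa using hz
  rw [map_neg, tensorDiff_tmul, hx, TensorProduct.tmul_neg, mul_one]
  abel

lemma tensorAug_tensorDiff (τ : R) (z : R ⊗[ℤ] M) :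
    tensorAug R M (tensorDiff M τ τ z) = 0 := by
  induction z with
  | zero => simp
  | add z w hz hw => simp [hz, hw]
  | tmul r m => simp [smul_smul, mul_comm]

/-- `R` has `ℤ`-basis `1, τ`, with `τ + τ' = t` and `τ * τ' = n`; the map `c` is the
coordinate of `τ`. -/
structure IsQuadGen (τ τ' : R) (t n : ℤ) (c : R →ₗ[ℤ] ℤ) : Prop where
  add : τ + τ' = t
  mul : τ * τ' = n
  span : ∀ r : R, ∃ a b : ℤ, r = a + b * τ
  coord_one : c 1 = 0
  coord_gen : c τ = 1

namespace IsQuadGen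

variable {τ τ' : R} {t n : ℤ} {c : R →ₗ[ℤ] ℤ}

lemma span' (h : IsQuadGen τ τ' t n c) (r : R) : ∃ a b : ℤ, r = a + b * τ' := by
  obtain ⟨a, b, rfl⟩ := h.span r
  refine ⟨a + b * t, -b, ?_⟩
  push_cast
  rw [← h.add]
  ring

lemma coord_conj (h : IsQuadGen τ τ' t n c) : c τ' = -1 := by
  have h1 : c (τ + τ') = t • c 1 := by rw [h.add, ← map_zsmul]; simp
  rw [map_add, h.coord_one, h.coord_gen, smul_zero] at h1
  linarith

lemma comp_conj (h : IsQuadGen τ τ' t n c) (z : R ⊗[ℤ] M) :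
    tensorDiff M τ τ (tensorDiff M τ τ' z) = 0 :=
  tensorDiff_comp (by ring) t h.add n h.mul z

lemma conj_comp (h : IsQuadGen τ τ' t n c) (z : R ⊗[ℤ] M) :
    tensorDiff M τ τ' (tensorDiff M τ τ z) = 0 :=
  tensorDiff_comp (by ring) t (by rw [add_comm, h.add]) n (by rw [mul_comm, h.mul]) z

lemma range_conj (h : IsQuadGen τ τ' t n c) :
    LinearMap.range (tensorDiff M τ τ') = LinearMap.ker (tensorDiff M τ τ) :=
  le_antisymm (by rintro _ ⟨z, rfl⟩; exact h.comp_conj z) fun z hz =>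
    exists_of_tensorDiff_eq_zero t h.add n h.mul h.span c h.coord_one (.inl h.coord_gen) z hz

lemma range_gen (h : IsQuadGen τ τ' t n c) :
    LinearMap.range (tensorDiff M τ τ) = LinearMap.ker (tensorDiff M τ τ') :=
  le_antisymm (by rintro _ ⟨z, rfl⟩; exact h.conj_comp z) fun z hz =>
    exists_of_tensorDiff_eq_zero t (by rw [add_comm, h.add]) n (by rw [mul_comm, h.mul])
      h.span' c h.coord_one (.inr h.coord_conj) z hz

lemma range_gen_eq_ker_aug (h : IsQuadGen τ τ' t n c) :
    LinearMap.range (tensorDiff M τ τ) = LinearMap.ker (tensorAug R M) :=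
  le_antisymm (by rintro _ ⟨z, rfl⟩; exact tensorAug_tensorDiff τ z) fun z hz =>
    exists_of_tensorAug_eq_zero h.span z hz

/-- The periodic complex `⋯ → R ⊗ M → R ⊗ M → R ⊗ M`. -/
noncomputable def complex (h : IsQuadGen τ τ' t n c) (M : Type) [AddCommGroup M] [Module R M] :
    ChainComplex (ModuleCat R) ℕ :=
  HomologicalComplex.alternatingConst (ModuleCat.of R (R ⊗[ℤ] M))
    (φ := ModuleCat.ofHom (tensorDiff M τ τ')) (ψ := ModuleCat.ofHom (tensorDiff M τ τ))
    (by ext1; exact LinearMap.ext h.comp_conj)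
    (by ext1; exact LinearMap.ext h.conj_comp)
    fun _ _ => ComplexShape.down_nat_odd_add

/-- The augmentation of the periodic complex. -/
noncomputable def complexAug (h : IsQuadGen τ τ' t n c) (M : Type) [AddCommGroup M] [Module R M] :
    h.complex M ⟶ (ChainComplex.single₀ (ModuleCat R)).obj (ModuleCat.of R M) :=
  ((h.complex M).toSingle₀Equiv _).symm ⟨ModuleCat.ofHom (tensorAug R M), by
    simp only [complex, HomologicalComplex.alternatingConst]
    ext1
    simpa using! LinearMap.ext (tensorAug_tensorDiff τ)⟩

lemma quasiIso_complexAug (h : IsQuadGen τ τ' t n c) (M : Type) [AddCommGroup M] [Module R M] :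
    QuasiIso (h.complexAug M) where
  quasiIsoAt m := by
    induction m with
    | zero =>
      simp only [complexAug]
      rw [ChainComplex.quasiIsoAt₀_iff, ShortComplex.quasiIso_iff_of_zeros' _ rfl rfl rfl]
      constructor
      · simpa [ShortComplex.moduleCat_exact_iff_range_eq_ker, complex,
          HomologicalComplex.alternatingConst, ChainComplex.toSingle₀Equiv] using!
          h.range_gen_eq_ker_aug
      · rw [ModuleCat.epi_iff_surjective]
        intro x
        use (1 : R) ⊗ₜ x
        simp [ChainComplex.toSingle₀Equiv]
        exact (tensorAug_tmul 1 x).trans (one_smul R x)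
    | succ m _ =>
      rw [quasiIsoAt_iff_exactAt' (hL := ChainComplex.exactAt_succ_single_obj ..),
          HomologicalComplex.exactAt_iff' _ (m + 2) (m + 1) m (by simp) (by simp)]
      rw [ShortComplex.moduleCat_exact_iff_range_eq_ker]
      by_cases hm : Odd (m + 1)
      · simpa [complex, if_pos (Nat.even_add_one.2 (Nat.not_even_iff_odd.2 hm)),
          if_neg (Nat.not_even_iff_odd.2 hm)] using! h.range_conj
      · simpa [complex, if_pos (Nat.not_odd_iff_even.1 hm),
          if_neg (Nat.not_even_iff_odd.2 <| Nat.odd_add_one.2 hm)] using! h.range_gen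

/-- The periodic projective resolution of an `R`-module that is free over `ℤ`. -/
noncomputable def resolution (h : IsQuadGen τ τ' t n c) (M : Type) [AddCommGroup M] [Module R M]
    [Module.Free ℤ M] : ProjectiveResolution (ModuleCat.of R M) where
  complex := h.complex M
  projective _ := inferInstanceAs <| Projective (ModuleCat.of R (R ⊗[ℤ] M))
  π := h.complexAug M
  quasiIso := h.quasiIso_complexAug M

end IsQuadGen

/-- The map `φ ↦ φ ∘ τ - s • φ` on `ℤ`-linear maps between `R`-modules. -/
noncomputable def homDiff (M N : Type) [AddCommGroup M] [Module R M] [AddCommGroup N] [Module R N] (τ s : R) :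
    (M →ₗ[ℤ] N) →ₗ[R] (M →ₗ[ℤ] N) where
  toFun φ := φ ∘ₗ mulZ M τ - s • φ
  map_add' φ ψ := by ext; simp; abel
  map_smul' r φ := by ext; simp [smul_sub, smul_smul, mul_comm]

variable {N : Type} [AddCommGroup N] [Module R N]

@[simp] lemma homDiff_apply (τ s : R) (φ : M →ₗ[ℤ] N) (x : M) :
    homDiff M N τ s φ x = φ (τ • x) - s • φ x := rfl

/-- `R`-linear maps `R ⊗ M → N` correspond to `ℤ`-linear maps `M → N`. -/
noncomputable def homTensorEquiv (R M N : Type) [CommRing R] [AddCommGroup M] [AddCommGroup N]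
    [Module R N] :
    (ModuleCat.of R (R ⊗[ℤ] M) ⟶ ModuleCat.of R N) ≃ₗ[R] (M →ₗ[ℤ] N) :=
  ModuleCat.homLinearEquiv (S := R) ≪≫ₗ (LinearMap.liftBaseChangeEquiv R).symm

lemma homTensorEquiv_comp (τ s : R) (f : ModuleCat.of R (R ⊗[ℤ] M) ⟶ ModuleCat.of R N) :
    homTensorEquiv R M N (ModuleCat.ofHom (tensorDiff M τ s) ≫ f) =
      homDiff M N τ s (homTensorEquiv R M N f) := by
  ext x
  have h : s ⊗ₜ[ℤ] x = s • ((1 : R) ⊗ₜ[ℤ] x) := by simp [TensorProduct.smul_tmul']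
  change f.hom (tensorDiff M τ s (1 ⊗ₜ x)) = f.hom (1 ⊗ₜ (τ • x)) - s • f.hom (1 ⊗ₜ x)
  rw [tensorDiff_tmul, map_sub, mul_one, h, map_smul]

namespace IsQuadGen

variable {τ τ' : R} {t n : ℤ} {c : R →ₗ[ℤ] ℤ}

lemma homDiff_comp (h : IsQuadGen τ τ' t n c) :
    homDiff M N τ τ' ∘ₗ homDiff M N τ τ = 0 := by
  ext φ x
  obtain ⟨f, rfl⟩ := (homTensorEquiv R M N).surjective φ
  rw [LinearMap.comp_apply, ← homTensorEquiv_comp, ← homTensorEquiv_comp, ← Category.assoc,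
    ← ModuleCat.ofHom_comp,
    show tensorDiff M τ τ ∘ₗ tensorDiff M τ τ' = 0 from LinearMap.ext h.comp_conj]
  change f.hom 0 = 0
  simp

/-- The short complex computing `Ext¹` from the periodic resolution. -/
noncomputable def homShortComplex (h : IsQuadGen τ τ' t n c) (M N : Type) [AddCommGroup M]
    [Module R M] [AddCommGroup N] [Module R N] : ShortComplex (ModuleCat R) :=
  ShortComplex.moduleCatMk (homDiff M N τ τ) (homDiff M N τ τ') h.homDiff_comp

/-- The complex `Hom(P, N)` in degrees `0, 1, 2`, in terms of `ℤ`-linear maps. -/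
noncomputable def scIso (h : IsQuadGen τ τ' t n c) (M N : Type) [AddCommGroup M]
    [Module R M] [AddCommGroup N] [Module R N] :
    ((h.complex M).linearYonedaObj R (ModuleCat.of R N)).sc' 0 1 2 ≅ h.homShortComplex M N :=
  ShortComplex.isoMk (homTensorEquiv R M N).toModuleIso (homTensorEquiv R M N).toModuleIso
    (homTensorEquiv R M N).toModuleIso
    (by
      ext1
      refine LinearMap.ext fun f => ?_
      simpa [complex, homShortComplex] using! (homTensorEquiv_comp τ τ f).symm)
    (by
      ext1
      refine LinearMap.ext fun f => ?_
      simpa [complex, homShortComplex] using! (homTensorEquiv_comp τ τ' f).symm)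

/-- `Ext¹` as the middle homology of `homShortComplex`. -/
noncomputable def extIso (h : IsQuadGen τ τ' t n c) (M N : Type) [AddCommGroup M]
    [Module R M] [AddCommGroup N] [Module R N] [Module.Free ℤ M] :
    ((Ext R (ModuleCat R) 1).obj (Opposite.op (ModuleCat.of R M))).obj (ModuleCat.of R N) ≅
      ModuleCat.of R (LinearMap.ker (homDiff M N τ τ') ⧸ LinearMap.range
        ((homDiff M N τ τ).codRestrict (LinearMap.ker (homDiff M N τ τ'))
          (LinearMap.congr_fun h.homDiff_comp))) :=
  (h.resolution M).isoExt 1 (ModuleCat.of R N) ≪≫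
    ShortComplex.homologyMapIso ((HomologicalComplex.isoSc' _ 0 1 2 (by simp) (by simp)) ≪≫
      h.scIso M N) ≪≫ (h.homShortComplex M N).moduleCatHomologyIso

/-- A surjection from `ker (homDiff τ τ')` whose kernel is the range of `homDiff τ τ` exhibits
its target as `Ext¹`. -/
lemma nonempty_ext_iso (h : IsQuadGen τ τ' t n c) [Module.Free ℤ M] {Q : Type} [AddCommGroup Q]
    [Module R Q] (g : LinearMap.ker (homDiff M N τ τ') →ₗ[R] Q) (hg : Function.Surjective g)
    (hker : ∀ ψ, g ψ = 0 ↔ ∃ φ, homDiff M N τ τ φ = ψ) :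
    Nonempty (((Ext R (ModuleCat R) 1).obj (Opposite.op (ModuleCat.of R M))).obj
      (ModuleCat.of R N) ≅ ModuleCat.of R Q) := by
  have hrange : LinearMap.range ((homDiff M N τ τ).codRestrict (LinearMap.ker (homDiff M N τ τ'))
      (LinearMap.congr_fun h.homDiff_comp)) = LinearMap.ker g := by
    ext ψ
    rw [LinearMap.mem_ker, hker]
    exact exists_congr fun φ => Subtype.ext_iff
  exact ⟨h.extIso M N ≪≫
    ((Submodule.quotEquivOfEq _ _ hrange).trans (g.quotKerEquivOfSurjective hg)).toModuleIso⟩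

end IsQuadGen

end PeriodicResolution

section Twisted

variable {M N : Type} [AddCommGroup M] [AddCommGroup N]

/-- The commutator-type map `φ ↦ φ ∘ α - β ∘ φ`. -/
noncomputable def commMap (α : M →ₗ[ℤ] M) (β : N →ₗ[ℤ] N) : (M →ₗ[ℤ] N) →ₗ[ℤ] (M →ₗ[ℤ] N) where
  toFun φ := φ ∘ₗ α - β ∘ₗ φ
  map_add' φ ψ := by ext; simp; abel
  map_smul' r φ := by ext; simp [smul_sub]

@[simp] lemma commMap_apply (α : M →ₗ[ℤ] M) (β : N →ₗ[ℤ] N) (φ : M →ₗ[ℤ] N) (x : M) :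
    commMap α β φ x = φ (α x) - β (φ x) := rfl

lemma range_commMap {α : M →ₗ[ℤ] M} {β : N →ₗ[ℤ] N} {t n m₁ m₂ : ℤ}
    (hα : ∀ x, α (α x) = t • α x - n • x) (hβ : ∀ y, β (β y) = t • β y - n • y)
    {e₁ : M →ₗ[ℤ] M} {e₂ : N →ₗ[ℤ] N}
    (he₁ : ∀ x, t • e₁ x - α (e₁ x) - e₁ (α x) = m₁ • x)
    (he₂ : ∀ y, t • e₂ y - β (e₂ y) - e₂ (β y) = m₂ • y) (hm : IsCoprime m₁ m₂) :
    LinearMap.range (commMap α β) =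
      LinearMap.ker (commMap α (t • LinearMap.id - β) : (M →ₗ[ℤ] N) →ₗ[ℤ] (M →ₗ[ℤ] N)) := by
  apply le_antisymm
  · rintro _ ⟨φ, rfl⟩
    ext x
    simp [hα, hβ, smul_sub]
    abel
  · intro ψ hψ
    have hψ' (x : M) : β (ψ x) = t • ψ x - ψ (α x) := by
      have := LinearMap.congr_fun (LinearMap.mem_ker.1 hψ) x
      simp only [commMap_apply, LinearMap.sub_apply, LinearMap.smul_apply, LinearMap.id_apply,
        LinearMap.zero_apply] at this
      rw [sub_eq_zero.1 this]
      abel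
    obtain ⟨u, v, huv⟩ := hm
    refine ⟨v • (e₂ ∘ₗ ψ) - u • (ψ ∘ₗ e₁), ?_⟩
    ext x
    have h1 : ψ (e₁ (α x)) - β (ψ (e₁ x)) = -(m₁ • ψ x) := by
      rw [hψ', ← map_smul ψ m₁, ← he₁]
      simp
    have h2 : e₂ (ψ (α x)) - β (e₂ (ψ x)) = m₂ • ψ x := by
      rw [← he₂, hψ']
      simp
    have h3 : commMap α β (v • (e₂ ∘ₗ ψ) - u • (ψ ∘ₗ e₁)) x =
        v • (e₂ (ψ (α x)) - β (e₂ (ψ x))) - u • (ψ (e₁ (α x)) - β (ψ (e₁ x))) := by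
      simp
    rw [h3, h1, h2, smul_neg, sub_neg_eq_add, smul_smul, smul_smul, ← add_smul, add_comm, huv,
      one_smul]

lemma finrank_ker_commMap_le [Module.Free ℤ N] [Module.Finite ℤ N] {α : M →ₗ[ℤ] M}
    (β : N →ₗ[ℤ] N) {b : M} (hb : ∀ ψ : M →ₗ[ℤ] N, ψ b = 0 → ψ (α b) = 0 → ψ = 0) :
    Module.finrank ℤ (LinearMap.ker (commMap α β)) ≤ Module.finrank ℤ N := by
  refine LinearMap.finrank_le_finrank_of_injective
    (f := (LinearMap.applyₗ b).comp (LinearMap.ker (commMap α β)).subtype) ?_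
  rw [injective_iff_map_eq_zero]
  rintro ⟨ψ, hψ⟩ h0
  have h0 : ψ b = 0 := h0
  have := LinearMap.congr_fun (LinearMap.mem_ker.1 hψ) b
  refine Subtype.ext (hb ψ h0 ?_)
  simpa [h0] using this

/-- The commuting maps and the anti-commuting maps have the same rank. -/
lemma nonempty_equiv_ker_commMap [Module.Free ℤ M] [Module.Finite ℤ M] [Module.Free ℤ N]
    [Module.Finite ℤ N] (hM : Module.finrank ℤ M = 2) (hN : Module.finrank ℤ N = 2)
    {α : M →ₗ[ℤ] M} {β β' : N →ₗ[ℤ] N} {b : M}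
    (hb : ∀ ψ : M →ₗ[ℤ] N, ψ b = 0 → ψ (α b) = 0 → ψ = 0)
    (hrange : LinearMap.range (commMap α β) = LinearMap.ker (commMap α β')) :
    Nonempty (LinearMap.ker (commMap α β') ≃ₗ[ℤ] LinearMap.ker (commMap α β)) := by
  have h1 := finrank_ker_commMap_le β hb
  have h2 := finrank_ker_commMap_le β' hb
  have h3 := Submodule.finrank_quotient_add_finrank (LinearMap.ker (commMap α β))
  rw [(commMap α β).quotKerEquivRange.finrank_eq, hrange, Module.finrank_linearMap, hM, hN] at h3
  exact ⟨LinearEquiv.ofFinrankEq _ _ (by omega)⟩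

end Twisted

section ExtQuotient

variable {R M N : Type} [CommRing R] [AddCommGroup M] [Module R M] [AddCommGroup N] [Module R N]

/-- The quotient `Hom_R(M, N) / k`. -/
abbrev HomQuot (R M N : Type) [CommRing R] [AddCommGroup M] [Module R M] [AddCommGroup N]
    [Module R N] (k : ℕ) : Type :=
  (M →ₗ[R] N) ⧸ LinearMap.range (k • (LinearMap.id : (M →ₗ[R] N) →ₗ[R] (M →ₗ[R] N)))

lemma HomQuot.nsmul_eq_zero {k : ℕ} (q : HomQuot R M N k) : k • q = 0 := by
  obtain ⟨φ, rfl⟩ := Submodule.Quotient.mk_surjective _ q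
  rw [← Submodule.Quotient.mk_smul, Submodule.Quotient.mk_eq_zero]
  exact ⟨φ, rfl⟩

variable {τ : R} {k : ℕ} {α : M →ₗ[ℤ] M} {β : N →ₗ[ℤ] N}

/-- A `ℤ`-linear map commuting with the action of a generator of `R` is `R`-linear. -/
noncomputable def kerCommMapToHom (hspan : ∀ r : R, ∃ a b : ℤ, r = a + b * τ)
    (hα : ∀ x, τ • x = k • α x) (hβ : ∀ y, τ • y = k • β y) :
    LinearMap.ker (commMap α β) →ₗ[ℤ] (M →ₗ[R] N) where
  toFun φ :=
    { toFun := φ.1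
      map_add' := φ.1.map_add
      map_smul' := fun r x => by
        obtain ⟨a, b, rfl⟩ := hspan r
        have h := LinearMap.congr_fun (LinearMap.mem_ker.1 φ.2) x
        rw [commMap_apply, LinearMap.zero_apply, sub_eq_zero] at h
        simp only [add_smul, mul_smul, hα, hβ, Int.cast_smul_eq_zsmul, map_add, map_zsmul,
          map_nsmul, h, RingHom.id_apply] }
  map_add' _ _ := rfl
  map_smul' _ _ := by ext; simp

lemma nsmul_eq_zero_iff_of_free {N : Type} [AddCommGroup N] [Module.Free ℤ N] {k : ℕ} (hk : k ≠ 0)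
    {y : N} : k • y = 0 ↔ y = 0 := by
  rw [← natCast_zsmul, smul_eq_zero, Nat.cast_eq_zero, or_iff_right hk]

lemma kerCommMapToHom_bijective [Module.Free ℤ N] (hk : k ≠ 0)
    (hspan : ∀ r : R, ∃ a b : ℤ, r = a + b * τ)
    (hα : ∀ x, τ • x = k • α x) (hβ : ∀ y, τ • y = k • β y) :
    Function.Bijective (kerCommMapToHom hspan hα hβ) := by
  refine ⟨fun φ ψ h => Subtype.ext (LinearMap.ext fun x => LinearMap.congr_fun h x), fun φ => ?_⟩
  refine ⟨⟨φ.restrictScalars ℤ, ?_⟩, rfl⟩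
  ext x
  have h : τ • φ x = φ (τ • x) := (φ.map_smul τ x).symm
  rw [hα, hβ, map_nsmul] at h
  rw [← sub_eq_zero, ← smul_sub, nsmul_eq_zero_iff_of_free hk, sub_eq_zero] at h
  simpa [sub_eq_zero] using h.symm

lemma mem_ker_homDiff_iff [Module.Free ℤ N] (hk : k ≠ 0) {τ' : R} {t : ℤ}
    (ht : τ + τ' = ((k * t : ℤ) : R))
    (hα : ∀ x, τ • x = k • α x) (hβ : ∀ y, τ • y = k • β y) (ψ : M →ₗ[ℤ] N) :
    ψ ∈ LinearMap.ker (homDiff M N τ τ') ↔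
      ψ ∈ LinearMap.ker (commMap α (t • LinearMap.id - β)) := by
  simp only [LinearMap.mem_ker, LinearMap.ext_iff]
  refine forall_congr' fun x => ?_
  have h : homDiff M N τ τ' ψ x = k • commMap α (t • LinearMap.id - β) ψ x := by
    rw [homDiff_apply, eq_sub_of_add_eq' ht, sub_smul, hβ, hα, Int.cast_smul_eq_zsmul]
    simp [mul_smul, smul_sub]
  rw [h, LinearMap.zero_apply, nsmul_eq_zero_iff_of_free hk]

/-- For modules over a quadratic order `R = ℤ[τ]` on which `τ` acts as `k` times endomorphisms
`α` and `β` with no common obstruction to splitting, `Ext¹` is `Hom / k`. -/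
theorem nonempty_ext_iso_homQuot [Module.Free ℤ M] [Module.Finite ℤ M] [Module.Free ℤ N]
    [Module.Finite ℤ N] (hM : Module.finrank ℤ M = 2) (hN : Module.finrank ℤ N = 2) (hk : k ≠ 0)
    {τ' : R} {t n n' m₁ m₂ : ℤ} {c : R →ₗ[ℤ] ℤ} (h : IsQuadGen τ τ' (k * t) n' c)
    (hα : ∀ x, τ • x = k • α x) (hβ : ∀ y, τ • y = k • β y)
    (hα2 : ∀ x, α (α x) = t • α x - n • x) (hβ2 : ∀ y, β (β y) = t • β y - n • y)
    {e₁ : M →ₗ[ℤ] M} {e₂ : N →ₗ[ℤ] N}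
    (he₁ : ∀ x, t • e₁ x - α (e₁ x) - e₁ (α x) = m₁ • x)
    (he₂ : ∀ y, t • e₂ y - β (e₂ y) - e₂ (β y) = m₂ • y) (hm : IsCoprime m₁ m₂)
    {b : M} (hb : ∀ ψ : M →ₗ[ℤ] N, ψ b = 0 → ψ (α b) = 0 → ψ = 0) :
    Nonempty (((Ext R (ModuleCat R) 1).obj (Opposite.op (ModuleCat.of R M))).obj
      (ModuleCat.of R N) ≅ ModuleCat.of R (HomQuot R M N k)) := by
  have hrange := range_commMap hα2 hβ2 he₁ he₂ hm
  obtain ⟨u⟩ := nonempty_equiv_ker_commMap hM hN hb hrange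
  set β' : N →ₗ[ℤ] N := t • LinearMap.id - β with hβ'
  have hmem := mem_ker_homDiff_iff (M := M) hk h.add hα hβ
  let w : LinearMap.ker (commMap α β') ≃ₗ[ℤ] (M →ₗ[R] N) :=
    u.trans (LinearEquiv.ofBijective _ (kerCommMapToHom_bijective hk h.span hα hβ))
  let v : LinearMap.ker (homDiff M N τ τ') →+ LinearMap.ker (commMap α β') :=
    { toFun := fun ψ => ⟨ψ.1, (hmem _).1 ψ.2⟩
      map_zero' := rfl
      map_add' := fun _ _ => rfl }
  let G : LinearMap.ker (homDiff M N τ τ') →+ HomQuot R M N k :=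
    ((Submodule.mkQ _).toAddMonoidHom.comp w.toLinearMap.toAddMonoidHom).comp v
  have hτ (q : HomQuot R M N k) : τ • q = 0 := by
    obtain ⟨φ, rfl⟩ := Submodule.Quotient.mk_surjective _ q
    rw [← Submodule.Quotient.mk_smul, Submodule.Quotient.mk_eq_zero]
    let χ : M →ₗ[R] N :=
      { toFun := fun x => β (φ x)
        map_add' := by simp
        map_smul' := fun r x => by
          obtain ⟨a, b, rfl⟩ := h.span r
          simp only [map_smul, add_smul, mul_smul, hβ, Int.cast_smul_eq_zsmul, map_add, map_zsmul,
            map_nsmul, RingHom.id_apply] }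
    exact ⟨χ, LinearMap.ext fun x => (hβ (φ x)).symm⟩
  have hGτ (ψ) : G (τ • ψ) = 0 := by
    have hχ : β ∘ₗ ψ.1 ∈ LinearMap.ker (homDiff M N τ τ') := by
      rw [hmem, LinearMap.mem_ker]
      ext x
      have := LinearMap.congr_fun (LinearMap.mem_ker.1 ((hmem _).1 ψ.2)) x
      rw [commMap_apply, LinearMap.zero_apply, sub_eq_zero] at this
      simp [this]
    have : τ • ψ = k • (⟨_, hχ⟩ : LinearMap.ker (homDiff M N τ τ')) := by
      ext x
      exact hβ (ψ.1 x)
    rw [this, map_nsmul, HomQuot.nsmul_eq_zero]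
  let g : LinearMap.ker (homDiff M N τ τ') →ₗ[R] HomQuot R M N k :=
    { G with
      map_smul' := fun r ψ => by
        obtain ⟨a, b, rfl⟩ := h.span r
        change G _ = ((a : R) + b * τ) • G ψ
        rw [add_smul, add_smul, mul_smul, mul_smul, hτ, map_add, Int.cast_smul_eq_zsmul,
          Int.cast_smul_eq_zsmul, map_zsmul, map_zsmul, hGτ, smul_zero, Int.cast_smul_eq_zsmul,
          smul_zero] }
  refine h.nonempty_ext_iso g (fun q => ?_) fun ψ => ?_
  · obtain ⟨φ, rfl⟩ := Submodule.Quotient.mk_surjective _ q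
    obtain ⟨χ, rfl⟩ := w.surjective φ
    exact ⟨⟨χ.1, (hmem _).2 χ.2⟩, rfl⟩
  · have hdiff (φ : M →ₗ[ℤ] N) : homDiff M N τ τ φ = k • commMap α β φ := by
      ext x
      simp [hα, hβ, smul_sub]
    change Submodule.Quotient.mk (w (v ψ)) = (0 : HomQuot R M N k) ↔ _
    rw [Submodule.Quotient.mk_eq_zero]
    constructor
    · rintro ⟨φ, hφ⟩
      obtain ⟨χ, rfl⟩ := w.surjective φ
      have hχ : χ.1 ∈ LinearMap.range (commMap α β) := by
        rw [hrange]
        exact χ.2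
      obtain ⟨φ, hφ'⟩ := hχ
      refine ⟨φ, ?_⟩
      have : k • χ = v ψ := w.injective (by rw [map_nsmul, ← hφ]; rfl)
      rw [hdiff, hφ']
      exact congrArg Subtype.val this
    · rintro ⟨φ, hφ⟩
      have hχ : commMap α β φ ∈ LinearMap.ker (commMap α β') := by
        rw [← hrange]
        exact ⟨φ, rfl⟩
      refine ⟨w ⟨_, hχ⟩, ?_⟩
      have : k • (⟨_, hχ⟩ : LinearMap.ker (commMap α β')) = v ψ :=
        Subtype.ext ((hdiff φ).symm.trans hφ)
      rw [← this, map_nsmul]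
      rfl

end ExtQuotient
section QuadraticField

lemma IsQuadGen.exists_of_span_of_indep {R : Type} [CommRing R] {τ τ' : R} {t n : ℤ}
    (hadd : τ + τ' = t) (hmul : τ * τ' = n) (hspan : ∀ r : R, ∃ a b : ℤ, r = a + b * τ)
    (indep : ∀ a b : ℤ, (a : R) + b * τ = 0 → b = 0) :
    ∃ c : R →ₗ[ℤ] ℤ, IsQuadGen τ τ' t n c := by
  choose a b hab using hspan
  have huniq (r : R) (x y : ℤ) (h : r = x + y * τ) : b r = y := by
    have := indep (a r - x) (b r - y) (by push_cast; linear_combination h - hab r)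
    omega
  let c : R →+ ℤ := AddMonoidHom.mk' b fun r s =>
    huniq _ (a r + a s) _ (by push_cast; linear_combination hab r + hab s)
  exact ⟨c.toIntLinearMap, hadd, hmul, fun r => ⟨a r, b r, hab r⟩, huniq 1 1 0 (by simp),
    huniq τ 0 1 (by simp)⟩

/-- `1, w` is an integral basis of `K`, and `w ^ 2 = t * w - n`. -/
structure IsIntegralGen (K : Type) [Field K] [NumberField K] (w : K) (t n : ℤ) : Prop where
  sq : w * w = t * w - n
  span : ∀ y : NumberField.RingOfIntegers K, ∃ a b : ℤ,
    algebraMap (NumberField.RingOfIntegers K) K y = a + b * w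
  mem : ∃ y : NumberField.RingOfIntegers K, algebraMap (NumberField.RingOfIntegers K) K y = w
  indep : ∀ a b : ℤ, (a : K) + b * w = 0 → b = 0

lemma exists_isIntegralGen (K : Type) [Field K] [NumberField K]
    (hdeg : Module.finrank ℚ K = 2) : ∃ (w : K) (t n : ℤ), IsIntegralGen K w t n := by
  have hrank : Module.finrank ℤ (NumberField.RingOfIntegers K) = 2 := by
    rw [NumberField.RingOfIntegers.rank, hdeg]
  let B := Module.finBasisOfFinrankEq ℤ (NumberField.RingOfIntegers K) hrank
  have hrepr (y : NumberField.RingOfIntegers K) : ∃ p q : ℤ, y = p * B 0 + q * B 1 :=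
    ⟨B.repr y 0, B.repr y 1, by
      conv_lhs => rw [← B.sum_repr y]
      simp [Fin.sum_univ_two]⟩
  have hB (p q : ℤ) (h : (p : NumberField.RingOfIntegers K) * B 0 + q * B 1 = 0) :
      p = 0 ∧ q = 0 := by
    have := Fintype.linearIndependent_iff.1 B.linearIndependent ![p, q]
      (by simpa [Fin.sum_univ_two] using h)
    exact ⟨this 0, this 1⟩
  obtain ⟨p, q, hpq⟩ := hrepr 1
  have hcop : IsCoprime p q := by
    rw [Int.isCoprime_iff_gcd_eq_one]
    obtain ⟨p', hp'⟩ := Int.gcd_dvd_left p q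
    obtain ⟨q', hq'⟩ := Int.gcd_dvd_right p q
    set g := Int.gcd p q
    have hu : IsUnit (algebraMap ℤ (NumberField.RingOfIntegers K) g) := by
      refine IsUnit.of_mul_eq_one (p' * B 0 + q' * B 1) ?_
      rw [hpq, hp', hq']
      simp
      ring
    have := hu.map (Algebra.norm ℤ)
    rw [Algebra.norm_algebraMap, hrank, isUnit_pow_iff two_ne_zero, Int.isUnit_iff] at this
    omega
  obtain ⟨u, v, huv⟩ := hcop
  have huv' : (u : NumberField.RingOfIntegers K) * p + v * q = 1 := by exact_mod_cast huv
  set ω : NumberField.RingOfIntegers K := -v * B 0 + u * B 1 with hω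
  have hspan (y : NumberField.RingOfIntegers K) : ∃ a b : ℤ, y = a + b * ω := by
    obtain ⟨r, s, rfl⟩ := hrepr y
    refine ⟨r * u + s * v, s * p - r * q, ?_⟩
    push_cast
    rw [← mul_one ((r : NumberField.RingOfIntegers K) * u + s * v)]
    conv_rhs => rw [hpq]
    rw [hω]
    linear_combination (-(r * B 0) - s * B 1) * huv'
  obtain ⟨n, t, hnt⟩ := hspan (ω * ω)
  refine ⟨algebraMap _ K ω, t, -n, ?_, fun y => ?_, ⟨ω, rfl⟩, fun a b hab => ?_⟩
  · rw [← map_mul, hnt]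
    simp
    ring
  · obtain ⟨a, b, rfl⟩ := hspan y
    exact ⟨a, b, by simp⟩
  · have h0 : (a : NumberField.RingOfIntegers K) + b * ω = 0 := by
      apply FaithfulSMul.algebraMap_injective (NumberField.RingOfIntegers K) K
      simpa using hab
    have h1 := hB (a * p - b * v) (a * q + b * u) (by
      push_cast
      rw [← h0, hω]
      linear_combination (-(a : NumberField.RingOfIntegers K)) * hpq)
    linear_combination p * h1.2 - q * h1.1 - b * huv

variable {K : Type} [Field K] [NumberField K] {w : K} {t n : ℤ}

lemma IsIntegralGen.mem_orderSet_iff (hw : IsIntegralGen K w t n) (m : ℕ) (x : K) :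
    x ∈ orderSet K m ↔ ∃ a b : ℤ, x = a + b * (m * w) := by
  constructor
  · rintro ⟨a, y, rfl⟩
    obtain ⟨c, d, hy⟩ := hw.span y
    exact ⟨a + m * c, d, by rw [hy]; push_cast; ring⟩
  · rintro ⟨a, b, rfl⟩
    obtain ⟨y, hy⟩ := hw.mem
    exact ⟨a, b * y, by rw [map_mul, hy, map_intCast]; ring⟩

lemma IsIntegralGen.exists_isQuadGen (hw : IsIntegralGen K w t n) {F : ℕ} (hF : F ≠ 0) :
    ∃ (τ τ' : orderSubring K F) (n' : ℤ) (c : orderSubring K F →ₗ[ℤ] ℤ),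
      (τ : K) = F * w ∧ IsQuadGen τ τ' (F * t) n' c := by
  have hmem (x : K) : x ∈ orderSubring K F ↔ ∃ a b : ℤ, x = a + b * (F * w) :=
    hw.mem_orderSet_iff F x
  let τ : orderSubring K F := ⟨F * w, (hmem _).2 ⟨0, 1, by simp⟩⟩
  let τ' : orderSubring K F := ⟨F * (t - w), (hmem _).2 ⟨F * t, -1, by push_cast; ring⟩⟩
  obtain ⟨c, hc⟩ := IsQuadGen.exists_of_span_of_indep (τ := τ) (τ' := τ') (t := F * t)
    (n := F * F * n) (Subtype.ext (by simp [τ, τ']; ring))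
    (Subtype.ext (by
      simp [τ, τ']
      linear_combination (-(F : K) * F) * hw.sq))
    (fun ⟨r, hr⟩ => by
      obtain ⟨a, b, rfl⟩ := (hmem r).1 hr
      exact ⟨a, b, Subtype.ext (by simp [τ])⟩)
    (fun a b h => by
      have h' := congrArg Subtype.val h
      have := hw.indep a (b * F) (by
        push_cast
        rw [mul_assoc]
        simpa [τ] using h')
      simpa [hF] using this)
  exact ⟨τ, τ', _, c, rfl, hc⟩

lemma IsLat.isLattice {L : Submodule ℤ K} (hL : IsLat K L) : Submodule.IsLattice ℚ L :=
  ⟨hL.1, hL.2⟩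

lemma IsLat.finrank_eq {L : Submodule ℤ K} (hL : IsLat K L) :
    Module.finrank ℤ L = Module.finrank ℚ K :=
  have := hL.isLattice
  congrArg Cardinal.toNat (Submodule.IsLattice.rank' ℚ L)

/-- Coordinates of multiplication by `c * w` on a lattice of conductor `c`. -/
lemma IsIntegralGen.exists_basis (hw : IsIntegralGen K w t n) (hdeg : Module.finrank ℚ K = 2)
    {L : Submodule ℤ K} (hL : IsLat K L) {f : ℕ} (hf : HasCond K L f) :
    ∃ (B : Module.Basis (Fin 2) ℤ L) (a b c d x y z : ℤ),
      f * w * (B 0 : K) = a * B 0 + c * B 1 ∧ f * w * (B 1 : K) = b * B 0 + d * B 1 ∧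
      c ≠ 0 ∧ f * t = a + d ∧ (a - d) * x + b * z + c * y = -1 := by
  have := hL.isLattice
  have : Module.Finite ℤ L := Submodule.IsLattice.finite ℚ L
  have : Module.Free ℤ L := Submodule.IsLattice.free ℚ L
  let B := Module.finBasisOfFinrankEq ℤ L (hL.finrank_eq.trans hdeg)
  have hf0 : f ≠ 0 := hf.1.ne'
  have hmult (x : K) : (∀ y ∈ L, x * y ∈ L) ↔ ∃ a b : ℤ, x = a + b * (f * w) := by
    rw [← hw.mem_orderSet_iff, ← hf.2]
    rfl
  have hrepr (x : K) (hx : x ∈ L) : ∃ p q : ℤ, x = p * B 0 + q * B 1 :=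
    ⟨B.repr ⟨x, hx⟩ 0, B.repr ⟨x, hx⟩ 1, by
      have h := congrArg Subtype.val (B.sum_repr ⟨x, hx⟩)
      rw [Fin.sum_univ_two] at h
      simpa only [Submodule.coe_add, Submodule.coe_smul, zsmul_eq_mul] using h.symm⟩
  have hfw := (hmult (f * w)).2 ⟨0, 1, by simp⟩
  obtain ⟨a, c, hac⟩ := hrepr _ (hfw _ (B 0).2)
  obtain ⟨b, d, hbd⟩ := hrepr _ (hfw _ (B 1).2)
  have hB0 : (B 0 : K) ≠ 0 := by simpa using B.ne_zero 0
  have hindep (p q : ℤ) (h : (p : K) + q * (f * w) = 0) : q = 0 := by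
    have := hw.indep p (q * f) (by push_cast; rw [← h]; ring)
    simpa [hf0] using this
  have hc : c ≠ 0 := by
    rintro rfl
    refine one_ne_zero (hindep (-a) 1 (mul_right_cancel₀ hB0 ?_))
    push_cast at hac ⊢
    linear_combination hac
  have htr : f * t = a + d := by
    have hchar : ((f : K) * w - a) * (f * w - d) = b * c := by
      apply mul_right_cancel₀ hB0
      linear_combination (f * w - d) * hac + c * hbd
    have := hindep (a * d - b * c - f * f * n) (f * t - (a + d)) (by
      push_cast
      linear_combination hchar - (f : K) * f * hw.sq)
    omega
  have hgcd : ∃ x y z : ℤ, (a - d) * x + b * z + c * y = -1 := by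
    set g := Int.gcd (a - d) (Int.gcd b c) with hg
    obtain ⟨p, hp⟩ : (g : ℤ) ∣ a - d := Int.gcd_dvd_left _ _
    obtain ⟨q, hq⟩ : (g : ℤ) ∣ b := (Int.gcd_dvd_right _ _).trans (Int.gcd_dvd_left _ _)
    obtain ⟨r, hr⟩ : (g : ℤ) ∣ c := (Int.gcd_dvd_right _ _).trans (Int.gcd_dvd_right _ _)
    have hg0 : (g : K) ≠ 0 := by
      rintro h
      rw [Nat.cast_eq_zero] at h
      exact hc (by rw [hr, h]; simp)
    have hpK : (a : K) - d = g * p := by exact_mod_cast congrArg (Int.cast (R := K)) hp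
    have hqK : (b : K) = g * q := by exact_mod_cast congrArg (Int.cast (R := K)) hq
    have hrK : (c : K) = g * r := by exact_mod_cast congrArg (Int.cast (R := K)) hr
    obtain ⟨u, v, huv⟩ := (hmult ((f * w - d) / g)).1 fun x hx => by
      obtain ⟨i, j, rfl⟩ := hrepr x hx
      have : ((f : K) * w - d) / g * (i * B 0 + j * B 1) =
          ((i * p + j * q : ℤ) : K) * B 0 + ((i * r : ℤ) : K) * B 1 := by
        rw [div_mul_eq_mul_div, div_eq_iff hg0]
        push_cast
        linear_combination i * hac + j * hbd + i * B 0 * hpK + j * B 0 * hqK + i * B 1 * hrK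
      rw [this, ← zsmul_eq_mul, ← zsmul_eq_mul]
      exact L.add_mem (L.smul_mem _ (B 0).2) (L.smul_mem _ (B 1).2)
    rw [div_eq_iff hg0] at huv
    have hv := hindep (-d - g * u) (1 - g * v) (by push_cast; linear_combination huv)
    have hg1 : g = 1 := by
      have : (g : ℤ) ∣ 1 := ⟨v, by omega⟩
      exact_mod_cast Int.eq_one_of_dvd_one (by positivity) this
    have h1 := Int.gcd_eq_gcd_ab (a - d) (Int.gcd b c)
    have h2 := Int.gcd_eq_gcd_ab b c
    rw [← hg, hg1] at h1
    set X := Int.gcdA (a - d) (Int.gcd b c)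
    set Y := Int.gcdB (a - d) (Int.gcd b c)
    refine ⟨-X, -(Int.gcdB b c * Y), -(Int.gcdA b c * Y), ?_⟩
    push_cast at h1
    linear_combination h1 + Y * h2
  obtain ⟨x, y, z, h⟩ := hgcd
  exact ⟨B, a, b, c, d, x, y, z, hac, hbd, hc, htr, h⟩

lemma Nat.coprime_of_mul_eq_lcm {a b m n : ℕ} (ha : a.lcm b = a * m) (hb : a.lcm b = b * n)
    (h0 : 0 < a.lcm b) : m.Coprime n := by
  obtain ⟨x, hx⟩ := Nat.gcd_dvd_left m n
  obtain ⟨y, hy⟩ := Nat.gcd_dvd_right m n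
  rw [Nat.Coprime]
  set g := m.gcd n
  have hg : 0 < g := Nat.pos_of_ne_zero fun h => h0.ne' (by rw [ha, hx, h]; simp)
  have hxy : a * x = b * y := Nat.eq_of_mul_eq_mul_left hg (by
    rw [Nat.mul_left_comm, ← hx, ← ha, hb, hy, Nat.mul_left_comm])
  have hlcm : a.lcm b = g * (a * x) := by rw [ha, hx, Nat.mul_left_comm]
  have hdvd : a.lcm b ∣ a * x := Nat.lcm_dvd (Dvd.intro _ rfl) (hxy ▸ Dvd.intro _ rfl)
  have hpos : 0 < a * x := Nat.pos_of_ne_zero fun h => h0.ne' (by rw [hlcm, h, mul_zero])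
  have hle := Nat.le_of_dvd hpos hdvd
  rw [hlcm] at hle
  exact le_antisymm (Nat.le_of_mul_le_mul_right (by simpa using hle) hpos) hg

/-- An almost-splitting of multiplication by `m * c * w` on a lattice of conductor `c`. -/
lemma IsIntegralGen.exists_splitting (hw : IsIntegralGen K w t n)
    (hdeg : Module.finrank ℚ K = 2) {L : Submodule ℤ K} (hL : IsLat K L) {f m : ℕ}
    (hf : HasCond K L f) (hm : m ≠ 0) (α : L →ₗ[ℤ] L) (hα : ∀ x, (α x : K) = m * (f * w) * x) :
    ∃ (e : L →ₗ[ℤ] L) (b : L),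
      (∀ v, ((m * f : ℤ) * t) • e v - α (e v) - e (α v) = (m : ℤ) • v) ∧
      ∀ (N : Type) [AddCommGroup N] [Module.Free ℤ N] (ψ : L →ₗ[ℤ] N),
        ψ b = 0 → ψ (α b) = 0 → ψ = 0 := by
  obtain ⟨B, a, b, c, d, x, y, z, hac, hbd, hc, htr, hxyz⟩ := hw.exists_basis hdeg hL hf
  have h0 : α (B 0) = (m * a : ℤ) • B 0 + (m * c : ℤ) • B 1 := by
    apply Subtype.ext
    rw [hα]
    simp only [Submodule.coe_add, Submodule.coe_smul, zsmul_eq_mul]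
    push_cast
    linear_combination (m : K) * hac
  have h1 : α (B 1) = (m * b : ℤ) • B 0 + (m * d : ℤ) • B 1 := by
    apply Subtype.ext
    rw [hα]
    simp only [Submodule.coe_add, Submodule.coe_smul, zsmul_eq_mul]
    push_cast
    linear_combination (m : K) * hbd
  let e : L →ₗ[ℤ] L := B.constr ℤ ![x • B 0 + z • B 1, y • B 0 - x • B 1]
  have he0 : e (B 0) = x • B 0 + z • B 1 := by simp [e]
  have he1 : e (B 1) = y • B 0 - x • B 1 := by simp [e]
  refine ⟨e, B 0, fun v => ?_, fun N _ _ ψ hψ hψα => B.ext fun i => ?_⟩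
  · have : ((m * f : ℤ) * t) • e - α ∘ₗ e - e ∘ₗ α = (m : ℤ) • LinearMap.id := by
      refine B.ext fun i => ?_
      fin_cases i
      · simp only [Fin.zero_eta, LinearMap.sub_apply, LinearMap.smul_apply, LinearMap.comp_apply,
          LinearMap.id_apply, he0, h0, map_add, map_zsmul, h1, he1]
        linear_combination (norm := module) (x * m * htr - m * hxyz) • B 0 + (z * m * htr) • B 1
      · simp only [Fin.mk_one, LinearMap.sub_apply, LinearMap.smul_apply, LinearMap.comp_apply,
          LinearMap.id_apply, he0, h0, map_add, map_sub, map_zsmul, h1, he1]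
        linear_combination (norm := module) (y * m * htr) • B 0 + (-(x * m) * htr - m * hxyz) • B 1
    exact LinearMap.congr_fun this v
  · fin_cases i
    · exact hψ
    · rw [h0, map_add, map_zsmul, map_zsmul, hψ, smul_zero, zero_add, smul_eq_zero] at hψα
      exact hψα.resolve_left (mul_ne_zero (by exact_mod_cast hm) hc)

lemma IsIntegralGen.mul_mem (hw : IsIntegralGen K w t n) {L : Submodule ℤ K} {f m : ℕ}
    (hf : HasCond K L f) (hm : f ∣ m) {r x : K} (hr : r ∈ orderSet K m) (hx : x ∈ L) :
    r * x ∈ L := by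
  obtain ⟨m, rfl⟩ := hm
  obtain ⟨a, b, rfl⟩ := (hw.mem_orderSet_iff _ _).1 hr
  have : (a + b * ((f * m : ℕ) * w) : K) ∈ orderSet K f :=
    (hw.mem_orderSet_iff _ _).2 ⟨a, b * m, by push_cast; ring⟩
  rw [← hf.2] at this
  exact this x hx

lemma IsIntegralGen.exists_mul (hw : IsIntegralGen K w t n) {L : Submodule ℤ K} {f m : ℕ}
    (hf : HasCond K L f) : ∃ α : L →ₗ[ℤ] L, ∀ x, (α x : K) = m * (f * w) * x := by
  have hmem (x : L) : m * (f * w) * (x : K) ∈ L :=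
    hw.mul_mem hf (dvd_mul_left f m)
      ((hw.mem_orderSet_iff _ _).2 ⟨0, 1, by push_cast; ring⟩) x.2
  exact ⟨(AddMonoidHom.mk' (fun x : L => (⟨_, hmem x⟩ : L)) fun x y =>
    Subtype.ext (mul_add _ _ _)).toIntLinearMap, fun _ => rfl⟩

end QuadraticField

end

/-- For a quadratic field `K` (real or imaginary), lattices `L₁, L₂` of conductors
`f₁, f₂` with `f = lcm(f₁, f₂)` and any `F` divisible by `f`: `L₁` and `L₂` are
`O_F`-modules, and `Ext¹_{O_F}(L₁, L₂) ≅ Hom_{O_F}(L₁, L₂)/((F/f)·Hom_{O_F}(L₁, L₂))`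
as `O_F`-modules. -/
theorem ext_iso_hom_quotient
    (hdeg : Module.finrank ℚ K = 2)
    (L₁ L₂ : Submodule ℤ K) (hL₁ : IsLat K L₁) (hL₂ : IsLat K L₂)
    (f₁ f₂ : ℕ) (hc₁ : HasCond K L₁ f₁) (hc₂ : HasCond K L₂ f₂)
    (f : ℕ) (hf : f = Nat.lcm f₁ f₂)
    (F : ℕ) (hF0 : 0 < F) (hF : f ∣ F) :
    (∀ r ∈ orderSubring K F, ∀ x ∈ L₁, r * x ∈ L₁) ∧
    (∀ r ∈ orderSubring K F, ∀ x ∈ L₂, r * x ∈ L₂) ∧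
    ∀ (h₁ : ∀ r ∈ orderSubring K F, ∀ x ∈ L₁, r * x ∈ L₁)
      (h₂ : ∀ r ∈ orderSubring K F, ∀ x ∈ L₂, r * x ∈ L₂),
      Nonempty (extOrderObj K (orderSubring K F) L₁ L₂ h₁ h₂ ≅
        homQuotObj K (orderSubring K F) L₁ L₂ h₁ h₂ (F / f)) := by
  obtain ⟨w, t, n, hw⟩ := exists_isIntegralGen K hdeg
  obtain ⟨m₁, hm₁⟩ : f₁ ∣ f := hf ▸ Nat.dvd_lcm_left f₁ f₂
  obtain ⟨m₂, hm₂⟩ : f₂ ∣ f := hf ▸ Nat.dvd_lcm_right f₁ f₂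
  refine ⟨fun r hr x hx => hw.mul_mem hc₁ ((Dvd.intro _ hm₁.symm).trans hF) hr hx,
    fun r hr x hx => hw.mul_mem hc₂ ((Dvd.intro _ hm₂.symm).trans hF) hr hx, fun h₁ h₂ => ?_⟩
  have hf0 : 0 < f := Nat.pos_of_dvd_of_pos hF hF0
  obtain ⟨k, rfl⟩ := hF
  rw [Nat.mul_div_cancel_left k hf0]
  have hk : k ≠ 0 := by
    rintro rfl
    exact hF0.ne' (mul_zero f)
  have hm₁0 : m₁ ≠ 0 := by
    rintro rfl
    exact hf0.ne' hm₁
  have hm₂0 : m₂ ≠ 0 := by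
    rintro rfl
    exact hf0.ne' hm₂
  have hcop : IsCoprime (m₁ : ℤ) m₂ :=
    Nat.isCoprime_iff_coprime.2
      (Nat.coprime_of_mul_eq_lcm (hf ▸ hm₁) (hf ▸ hm₂) (hf ▸ hf0))
  obtain ⟨τ, τ', n', c, hτ, hgen⟩ := hw.exists_isQuadGen hF0.ne'
  obtain ⟨α, hα⟩ := hw.exists_mul (m := m₁) hc₁
  obtain ⟨β, hβ⟩ := hw.exists_mul (m := m₂) hc₂
  obtain ⟨e₁, b, he₁, hb⟩ := hw.exists_splitting hdeg hL₁ hc₁ hm₁0 α hα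
  obtain ⟨e₂, -, he₂, -⟩ := hw.exists_splitting hdeg hL₂ hc₂ hm₂0 β hβ
  have hfK₁ : (f : K) = f₁ * m₁ := by exact_mod_cast congrArg (Nat.cast (R := K)) hm₁
  have hfK₂ : (f : K) = f₂ * m₂ := by exact_mod_cast congrArg (Nat.cast (R := K)) hm₂
  have hfZ₁ : (m₁ * f₁ : ℤ) = f := by rw [hm₁]; push_cast; ring
  have hfZ₂ : (m₂ * f₂ : ℤ) = f := by rw [hm₂]; push_cast; ring
  rw [hfZ₁] at he₁
  rw [hfZ₂] at he₂
  have := hL₁.isLattice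
  have := hL₂.isLattice
  have : Module.Finite ℤ L₁ := Submodule.IsLattice.finite ℚ L₁
  have : Module.Finite ℤ L₂ := Submodule.IsLattice.finite ℚ L₂
  have : Module.Free ℤ L₁ := Submodule.IsLattice.free ℚ L₁
  have : Module.Free ℤ L₂ := Submodule.IsLattice.free ℚ L₂
  let := latticeModule K (orderSubring K (f * k)) L₁ h₁
  let := latticeModule K (orderSubring K (f * k)) L₂ h₂
  have hindex : ((f * k : ℕ) : ℤ) * t = k * (f * t) := by push_cast; ring
  rw [hindex] at hgen
  have hα2 (x : L₁) : α (α x) = ((f : ℤ) * t) • α x - (f * f * n : ℤ) • x := by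
    apply Subtype.ext
    simp only [Submodule.coe_sub, Submodule.coe_smul, zsmul_eq_mul, hα]
    push_cast
    rw [hfK₁]
    linear_combination (m₁ * m₁ * f₁ * f₁ * x : K) * hw.sq
  have hβ2 (x : L₂) : β (β x) = ((f : ℤ) * t) • β x - (f * f * n : ℤ) • x := by
    apply Subtype.ext
    simp only [Submodule.coe_sub, Submodule.coe_smul, zsmul_eq_mul, hβ]
    push_cast
    rw [hfK₂]
    linear_combination (m₂ * m₂ * f₂ * f₂ * x : K) * hw.sq
  have hτα (x : L₁) : τ • x = k • α x := by
    apply Subtype.ext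
    rw [Submodule.coe_smul_of_tower, hα, nsmul_eq_mul]
    change (τ : K) * x = _
    rw [hτ]
    push_cast
    rw [hfK₁]
    ring
  have hτβ (x : L₂) : τ • x = k • β x := by
    apply Subtype.ext
    rw [Submodule.coe_smul_of_tower, hβ, nsmul_eq_mul]
    change (τ : K) * x = _
    rw [hτ]
    push_cast
    rw [hfK₂]
    ring
  exact nonempty_ext_iso_homQuot (hL₁.finrank_eq.trans hdeg) (hL₂.finrank_eq.trans hdeg) hk hgen
    hτα hτβ hα2 hβ2 he₁ he₂ hcop (hb L₂)

end
end
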